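/- arXiv:math/0006015 — 3 statements merged into one kernel-verified Lean document; each statement's English description precedes it below -/
import Mathlib

section
/- (Comparison theorem for viscosity supersolutions) Assume L : ℝⁿ × ℝⁿ → [0,∞) is lower semicontinuous, locally bounded, convex in its second variable, and satisfies L(x,u) ≥ Θ(u) with Θ superlinear. Let W : [0,∞) × ℝⁿ → [0,∞] be lower semicontinuous, satisfy (a) D↑W(t,x)(0,0) = 0 for all (t,x) ∈ dom(W) with t > 0, (b) for all (t,x) ∈ dom(W) with t > 0 there exists u ∈ ℝⁿ with D↑W(t,x)(−1,u) < +∞, (c) W(0,·) = φ, and (d) for all (t,x) with t > 0 and all (p_t, p_x) ∈ ∂₋W(t,x): p_t + H(x, −p_x) ≥ 0, where H(x,p) = sup_u (⟨p,u⟩ − L(x,u)). Then W(t,x) ≥ V(t,x) for all (t,x) ∈ [0,∞) × ℝⁿ, where V is the value function of the Bolza problem. -/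
open Filter Topology Metric Set
open scoped RealInnerProductSpace

noncomputable section

abbrev Euc (n : ℕ) := EuclideanSpace ℝ (Fin n)

def contCone {F : Type*} [NormedAddCommGroup F] [NormedSpace ℝ F] (K : Set F) (x : F) : Set F :=
  {v | ∀ ε > 0, ∃ h : ℝ, 0 < h ∧ h < ε ∧ Metric.infDist (x + h • v) K < ε * h}

def Dup {F : Type*} [NormedAddCommGroup F] [NormedSpace ℝ F]
    (W : F → EReal) (x u : F) : EReal :=
  Filter.liminf (fun p : ℝ × F => ((p.1⁻¹ : ℝ) : EReal) * (W (x + p.1 • p.2) - W x))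
    ((𝓝[>] (0:ℝ)) ×ˢ 𝓝 u)

def Ham {n : ℕ} (L : Euc n → Euc n → ℝ) (x p : Euc n) : EReal :=
  ⨆ u : Euc n, ((⟪p, u⟫ - L x u : ℝ) : EReal)

def subdiffP {n : ℕ} (W : ℝ × Euc n → EReal) (q : ℝ × Euc n) : Set (ℝ × Euc n) :=
  {p | ∀ ε > 0, ∀ᶠ z in 𝓝 q,
    W q + ((p.1 * (z.1 - q.1) + ⟪p.2, z.2 - q.2⟫ - ε * ‖z - q‖ : ℝ) : EReal) ≤ W z}

def bolzaValue {n : ℕ} (L : Euc n → Euc n → ℝ) (φ : Euc n → EReal) (t : ℝ) (x : Euc n) : EReal :=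
  sInf {c : EReal | ∃ u : ℝ → Euc n,
    IntervalIntegrable u MeasureTheory.volume 0 t ∧
    IntervalIntegrable (fun s => L (x + ∫ τ in (0:ℝ)..s, u τ) (u s)) MeasureTheory.volume 0 t ∧
    c = ((∫ s in (0:ℝ)..t, L (x + ∫ τ in (0:ℝ)..s, u τ) (u s) : ℝ) : EReal)
        + φ (x + ∫ τ in (0:ℝ)..t, u τ)}

def Superlinear {n : ℕ} (Θ : Euc n → ℝ) : Prop :=
  Filter.Tendsto (fun u : Euc n => Θ u / ‖u‖) (Filter.comap norm Filter.atTop) Filter.atTop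

def negPolar {n : ℕ} (T : Set (Euc n)) : Set (Euc n) :=
  {v | ∀ w ∈ T, ⟪v, w⟫ ≤ 0}

/-- A nonnegative superlinear function dominates every affine function of the norm. -/
lemma Superlinear.exists_affine_norm_le {n : ℕ} {Θ : Euc n → ℝ} (hΘ : Superlinear Θ)
    (hΘ0 : ∀ u, 0 ≤ Θ u) {M : ℝ} (hM : 0 ≤ M) :
    ∃ K : ℝ, 0 ≤ K ∧ ∀ u, M * ‖u‖ - K ≤ Θ u := by
  have h := (tendsto_atTop.1 hΘ M)
  rw [eventually_comap, eventually_atTop] at h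
  obtain ⟨R, hR⟩ := h
  refine ⟨M * max R 1, by positivity, fun u => ?_⟩
  by_cases hu : max R 1 ≤ ‖u‖
  · have h1 := hR ‖u‖ ((le_max_left _ _).trans hu) u rfl
    have h2 : 0 < ‖u‖ := lt_of_lt_of_le (by positivity) hu
    rw [le_div_iff₀ h2] at h1
    have : 0 ≤ M * max R 1 := by positivity
    linarith
  · have := mul_le_mul_of_nonneg_left (not_le.1 hu).le hM
    linarith [hΘ0 u]

/-- A lower semicontinuous, coercive integrand which is convex in the velocity is locally
bounded from below by an affine function of the velocity that is almost optimal at a given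
velocity. -/
lemma exists_locally_uniform_affine_minorant {n : ℕ} {L : Euc n → Euc n → ℝ} {Θ : Euc n → ℝ}
    (hLlsc : LowerSemicontinuous (fun q : Euc n × Euc n => L q.1 q.2))
    (hconv : ∀ x, ConvexOn ℝ Set.univ (L x))
    (hΘ0 : ∀ u, 0 ≤ Θ u) (hΘ : Superlinear Θ) (hcoer : ∀ x u, Θ u ≤ L x u)
    (x v : Euc n) {η : ℝ} (hη : 0 < η) :
    ∃ (p : Euc n) (c r : ℝ), 0 < r ∧ (∀ x', ‖x' - x‖ < r → ∀ u, ⟪p, u⟫ + c ≤ L x' u) ∧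
      L x v - η ≤ ⟪p, v⟫ + c := by
  have hlx : LowerSemicontinuous (L x) := hLlsc.comp (Continuous.prodMk_right x)
  obtain ⟨l, c, hl, hv⟩ := (hconv x).exists_affine_le_of_lt (𝕜 := ℝ) (mem_univ v)
    (show L x v - η / 2 < L x v by linarith) isClosed_univ (hlx.lowerSemicontinuousOn _)
  set p : Euc n := (InnerProductSpace.toDual ℝ (Euc n)).symm l with hp
  have hpl : ∀ u, ⟪p, u⟫ = l u := fun u => by simp [hp]
  have hle : ∀ u, ⟪p, u⟫ + c ≤ L x u := fun u => by
    have := hl ⟨u, mem_univ u⟩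
    simpa [hpl] using this
  obtain ⟨K, hK0, hK⟩ := hΘ.exists_affine_norm_le hΘ0 (M := ‖p‖ + 1) (by positivity)
  have hnear : ∀ᶠ x' in 𝓝 x, ∀ u ∈ closedBall (0 : Euc n) (K + |c|),
      ⟪p, u⟫ + c - η / 2 < L x' u := by
    refine (isCompact_closedBall _ _).eventually_forall_of_forall_eventually fun u _ => ?_
    have h1 : LowerSemicontinuous (fun q : Euc n × Euc n => L q.1 q.2 + -(⟪p, q.2⟫ + c)) :=
      hLlsc.add (Continuous.lowerSemicontinuous (by fun_prop))
    have h2 := h1 (x, u) (-(η / 2)) (by have := hle u; simp only; linarith)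
    filter_upwards [h2] with q hq
    linarith
  obtain ⟨r, hr, hball⟩ := Metric.eventually_nhds_iff.1 hnear
  refine ⟨p, c - η / 2, r, hr, fun x' hx' u => ?_, ?_⟩
  · by_cases hu : ‖u‖ ≤ K + |c|
    · have := hball (by rwa [dist_eq_norm]) u (by simpa using hu)
      linarith
    · have h1 := real_inner_le_norm p u
      have h2 := hK u
      have h3 := hcoer x' u
      have h4 := le_abs_self c
      push Not at hu
      nlinarith
  · have : ⟪p, v⟫ + c = L x v - η / 2 := by simpa [hpl] using hv
    linarith

/-- The increments of a monotone function over disjoint intervals sum up to at most its total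
increment. -/
lemma MonotoneOn.sum_dist_le_of_mem_disjWithin {f : ℝ → ℝ} {a b : ℝ} (hab : a ≤ b)
    (hf : MonotoneOn f (Icc a b)) {E : ℕ × (ℕ → ℝ × ℝ)}
    (hE : E ∈ AbsolutelyContinuousOnInterval.disjWithin a b) :
    ∑ i ∈ Finset.range E.1, dist (f (E.2 i).1) (f (E.2 i).2) ≤ f b - f a := by
  obtain ⟨hmem, hdisj⟩ := hE
  rw [uIcc_of_le hab] at hmem
  have hf0 : f a ≤ f b := hf (by simp [hab]) (by simp [hab]) hab
  have hkey : ∀ z w : ℝ × ℝ, z.1 ∈ Icc a b → z.2 ∈ Icc a b → w.1 ∈ Icc a b → w.2 ∈ Icc a b →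
      ∀ v, v ∈ uIoc (f z.1) (f z.2) → v ∈ uIoc (f w.1) (f w.2) → min z.1 z.2 < max w.1 w.2 := by
    intro z w hz1 hz2 hw1 hw2 v hv hv'
    by_contra! hcon
    have h1 : max (f w.1) (f w.2) ≤ min (f z.1) (f z.2) := by
      refine max_le (le_min ?_ ?_) (le_min ?_ ?_) <;>
        refine hf (by assumption) (by assumption) ?_ <;> grind
    rw [mem_uIoc] at hv hv'
    grind
  have hd : (Finset.range E.1 : Set ℕ).PairwiseDisjoint
      (fun i => uIoc (f (E.2 i).1) (f (E.2 i).2)) := by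
    intro i hi j hj hij
    obtain ⟨hi1, hi2⟩ := hmem i hi
    obtain ⟨hj1, hj2⟩ := hmem j hj
    refine Set.disjoint_left.2 fun v hv hv' => ?_
    have h1 := hkey _ _ hi1 hi2 hj1 hj2 v hv hv'
    have h2 := hkey _ _ hj1 hj2 hi1 hi2 v hv' hv
    have h3 : (E.2 i).1 ≠ (E.2 i).2 := fun h => by simp [h] at hv
    have h4 : (E.2 j).1 ≠ (E.2 j).2 := fun h => by simp [h] at hv'
    set m := min (max (E.2 i).1 (E.2 i).2) (max (E.2 j).1 (E.2 j).2) with hm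
    refine Set.disjoint_left.1 (hdisj hi hj hij) (show m ∈ _ from ?_) (show m ∈ _ from ?_) <;>
      · simp only [mem_uIoc]
        grind
  have hsub : (⋃ i ∈ Finset.range E.1, uIoc (f (E.2 i).1) (f (E.2 i).2)) ⊆ Ioc (f a) (f b) := by
    refine iUnion₂_subset fun i hi v hv => ?_
    obtain ⟨⟨h1, h2⟩, h3, h4⟩ := hmem i hi
    have g1 := hf ⟨le_rfl, hab⟩ ⟨h1, h2⟩ h1
    have g2 := hf ⟨le_rfl, hab⟩ ⟨h3, h4⟩ h3
    have g3 := hf ⟨h1, h2⟩ ⟨hab, le_rfl⟩ h2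
    have g4 := hf ⟨h3, h4⟩ ⟨hab, le_rfl⟩ h4
    rw [mem_uIoc] at hv
    constructor <;> grind
  have hvol := MeasureTheory.measure_mono (μ := MeasureTheory.volume) hsub
  rw [MeasureTheory.measure_biUnion_finset hd (fun _ _ => measurableSet_uIoc)] at hvol
  simp only [Real.volume_uIoc, Real.volume_Ioc] at hvol
  rw [← ENNReal.ofReal_sum_of_nonneg (fun _ _ => abs_nonneg _),
    ENNReal.ofReal_le_ofReal_iff (by linarith)] at hvol
  simpa only [Real.dist_eq, abs_sub_comm] using hvol

/-- A curve whose increments are controlled, with arbitrarily large weight, by those of a monotone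
function is absolutely continuous. -/
lemma absolutelyContinuousOnInterval_of_superlinear_bound {X : Type*} [PseudoMetricSpace X]
    {T : ℝ} (hT : 0 ≤ T) {Y : ℝ → X} {F : ℝ → ℝ} (hF : MonotoneOn F (Icc 0 T))
    (hY : ∀ M : ℝ, 0 ≤ M → ∃ K : ℝ, 0 ≤ K ∧ ∀ a b, 0 ≤ a → a ≤ b → b ≤ T →
      M * dist (Y a) (Y b) ≤ F b - F a + K * (b - a)) :
    AbsolutelyContinuousOnInterval Y 0 T := by
  rw [absolutelyContinuousOnInterval_iff]
  intro ε hε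
  have hF0 : F 0 ≤ F T := hF (by simp [hT]) (by simp [hT]) hT
  set M := 2 * (F T - F 0 + 1) / ε with hM
  have hM0 : 0 < M := by
    have : 0 < F T - F 0 + 1 := by linarith
    positivity
  obtain ⟨K, hK0, hK⟩ := hY M hM0.le
  refine ⟨1 / (K + 1), by positivity, fun E hE hlen => ?_⟩
  have hsum := hF.sum_dist_le_of_mem_disjWithin hT hE
  obtain ⟨hmem, -⟩ := hE
  rw [uIcc_of_le hT] at hmem
  have hterm : ∀ i ∈ Finset.range E.1, M * dist (Y (E.2 i).1) (Y (E.2 i).2) ≤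
      dist (F (E.2 i).1) (F (E.2 i).2) + K * dist (E.2 i).1 (E.2 i).2 := by
    intro i hi
    obtain ⟨⟨h1, h2⟩, h3, h4⟩ := hmem i hi
    rcases le_total (E.2 i).1 (E.2 i).2 with h | h
    · have := hK _ _ h1 h h4
      rw [dist_comm (F _), dist_comm (E.2 i).1, Real.dist_eq, Real.dist_eq,
        abs_of_nonneg (sub_nonneg.2 h)]
      linarith [le_abs_self (F (E.2 i).2 - F (E.2 i).1)]
    · have := hK _ _ h3 h h2
      rw [dist_comm (Y _), Real.dist_eq, Real.dist_eq, abs_of_nonneg (sub_nonneg.2 h)]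
      linarith [le_abs_self (F (E.2 i).1 - F (E.2 i).2)]
  have htot := Finset.sum_le_sum hterm
  rw [Finset.sum_add_distrib, ← Finset.mul_sum, ← Finset.mul_sum] at htot
  rw [lt_div_iff₀ (by positivity)] at hlen
  have hn : 0 ≤ ∑ i ∈ Finset.range E.1, dist (E.2 i).1 (E.2 i).2 :=
    Finset.sum_nonneg fun _ _ => dist_nonneg
  have h1 : M * ∑ i ∈ Finset.range E.1, dist (Y (E.2 i).1) (Y (E.2 i).2) < M * ε := by
    have : M * ε = 2 * (F T - F 0 + 1) := by rw [hM]; field_simp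
    nlinarith
  exact lt_of_mul_lt_mul_left h1 hM0.le

lemma HasDerivAt.nonneg_of_right_min {g : ℝ → ℝ} {g' s ρ : ℝ} (hg : HasDerivAt g g' s)
    (hρ : 0 < ρ) (hmin : ∀ b ∈ Icc s (s + ρ), g s ≤ g b) : 0 ≤ g' := by
  have h1 : Tendsto (slope g s) (𝓝[>] s) (𝓝 g') :=
    (hasDerivAt_iff_tendsto_slope.1 hg).mono_left (nhdsWithin_mono _ fun x hx => ne_of_gt hx)
  refine ge_of_tendsto h1 ?_
  filter_upwards [Ioo_mem_nhdsGT (show s < s + ρ by linarith)] with b hb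
  rw [slope_def_field]
  exact div_nonneg (sub_nonneg.2 (hmin b ⟨hb.1.le, hb.2.le⟩)) (sub_nonneg.2 hb.1.le)

/-- A curve along which a monotone function dominates all local affine minorants of `L` is
generated by a control whose running cost is dominated by the increment of that function. -/
lemma exists_control_of_affine_minorant_bound {n : ℕ} {L : Euc n → Euc n → ℝ} {Θ : Euc n → ℝ}
    (hL0 : ∀ x u, 0 ≤ L x u)
    (hLlsc : LowerSemicontinuous (fun q : Euc n × Euc n => L q.1 q.2))
    (hconv : ∀ x, ConvexOn ℝ Set.univ (L x))
    (hΘ0 : ∀ u, 0 ≤ Θ u) (hΘ : Superlinear Θ) (hcoer : ∀ x u, Θ u ≤ L x u)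
    {T : ℝ} (hT : 0 ≤ T) {Y : ℝ → Euc n} {F : ℝ → ℝ} (hF : MonotoneOn F (Icc 0 T))
    (hY : ∀ M : ℝ, 0 ≤ M → ∃ K : ℝ, 0 ≤ K ∧ ∀ a b, 0 ≤ a → a ≤ b → b ≤ T →
      M * dist (Y a) (Y b) ≤ F b - F a + K * (b - a))
    (hminor : ∀ s ∈ Ioo 0 T, ∀ (p : Euc n) (c r : ℝ), 0 < r →
      (∀ x', ‖x' - Y s‖ < r → ∀ u, ⟪p, u⟫ + c ≤ L x' u) →
      ∃ ρ > 0, ∀ b ∈ Icc s (s + ρ), ⟪p, Y b - Y s⟫ + c * (b - s) ≤ F b - F s) :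
    ∃ u : ℝ → Euc n, IntervalIntegrable u MeasureTheory.volume 0 T ∧
      (∀ s ∈ Icc 0 T, Y 0 + ∫ τ in (0:ℝ)..s, u τ = Y s) ∧
      IntervalIntegrable (fun s => L (Y s) (u s)) MeasureTheory.volume 0 T ∧
      ∫ s in (0:ℝ)..T, L (Y s) (u s) ≤ F T - F 0 := by
  have hac := absolutelyContinuousOnInterval_of_superlinear_bound hT hF hY
  have hacI : ∀ i, AbsolutelyContinuousOnInterval (fun τ => Y τ i) 0 T := fun i =>
    absolutelyContinuousOnInterval_of_superlinear_bound hT hF fun M hM => by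
      obtain ⟨K, hK0, hK⟩ := hY M hM
      refine ⟨K, hK0, fun a b ha hab hb => le_trans ?_ (hK a b ha hab hb)⟩
      refine mul_le_mul_of_nonneg_left ?_ hM
      rw [dist_eq_norm, dist_eq_norm]
      exact PiLp.norm_apply_le (Y a - Y b) i
  set u : ℝ → Euc n :=
    fun τ => ∑ i, deriv (fun σ => Y σ i) τ • EuclideanSpace.single i (1 : ℝ) with hu
  have hsum : ∀ y : Euc n, ∑ i, y i • EuclideanSpace.single i (1 : ℝ) = y := fun y => by
    ext j
    simp [Pi.single_apply]
  have hui : ∀ i, IntervalIntegrable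
      (fun τ => deriv (fun σ => Y σ i) τ • (EuclideanSpace.single i (1 : ℝ) : Euc n))
      MeasureTheory.volume 0 T := fun i =>
    ⟨(hacI i).intervalIntegrable_deriv.1.smul_const _,
      (hacI i).intervalIntegrable_deriv.2.smul_const _⟩
  have huint : IntervalIntegrable u MeasureTheory.volume 0 T := by
    have := IntervalIntegrable.sum Finset.univ (fun i _ => hui i)
    simpa [hu, Finset.sum_fn] using this
  have hYu : ∀ s ∈ Icc 0 T, Y 0 + ∫ τ in (0:ℝ)..s, u τ = Y s := by
    intro s hs
    have hsub : uIcc 0 s ⊆ uIcc 0 T := by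
      rw [uIcc_of_le hs.1, uIcc_of_le hT]; exact Icc_subset_Icc le_rfl hs.2
    have h1 : ∫ τ in (0:ℝ)..s, u τ = Y s - Y 0 := by
      rw [hu, intervalIntegral.integral_finsetSum fun i _ => (hui i).mono_set hsub]
      simp_rw [intervalIntegral.integral_smul_const]
      rw [← hsum (Y s - Y 0)]
      refine Finset.sum_congr rfl fun i _ => ?_
      rw [((hacI i).mono hsub).integral_deriv_eq_sub]
      simp
    rw [h1]; abel
  have hae : ∀ᵐ s, s ∈ Ioo 0 T → HasDerivAt F (deriv F s) s ∧ HasDerivAt Y (u s) s := by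
    have h2 : ∀ᵐ s, ∀ i, s ∈ uIcc 0 T → DifferentiableAt ℝ (fun σ => Y σ i) s :=
      MeasureTheory.ae_all_iff.2 fun i => (hacI i).ae_differentiableAt
    filter_upwards [hF.ae_differentiableWithinAt_of_mem, h2] with s h1 h2 hs
    have hs' : s ∈ Icc 0 T := Ioo_subset_Icc_self hs
    refine ⟨((h1 hs').differentiableAt (Icc_mem_nhds hs.1 hs.2)).hasDerivAt, ?_⟩
    have h3 : HasDerivAt (fun τ => ∑ i, Y τ i • (EuclideanSpace.single i (1 : ℝ) : Euc n))
        (u s) s :=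
      HasDerivAt.fun_sum fun i _ =>
        ((h2 i (by rwa [uIcc_of_le hT])).hasDerivAt.smul_const _)
    simpa only [hsum] using h3
  have hle : ∀ᵐ s, s ∈ Ioo 0 T → L (Y s) (u s) ≤ deriv F s := by
    filter_upwards [hae] with s hs hsT
    obtain ⟨hF', hY'⟩ := hs hsT
    refine le_of_forall_pos_le_add fun η hη => ?_
    obtain ⟨p, c, r, hr, hmin, hval⟩ :=
      exists_locally_uniform_affine_minorant hLlsc hconv hΘ0 hΘ hcoer (Y s) (u s) hη
    obtain ⟨ρ, hρ, hb⟩ := hminor s hsT p c r hr hmin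
    have hd : HasDerivAt (fun b => F b - ⟪p, Y b⟫ - c * b) (deriv F s - ⟪p, u s⟫ - c) s := by
      have h1 : HasDerivAt (fun b => ⟪p, Y b⟫) ⟪p, u s⟫ s := by
        simpa using (hasDerivAt_const s p).inner ℝ hY'
      simpa using (hF'.fun_sub h1).fun_sub ((hasDerivAt_id s).const_mul c)
    have := hd.nonneg_of_right_min hρ fun b hbm => by
      have := hb b hbm
      rw [inner_sub_right] at this
      linarith
    linarith
  have hae' : ∀ᵐ s ∂(MeasureTheory.volume.restrict (Ioc 0 T)), L (Y s) (u s) ≤ deriv F s := by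
    rw [← MeasureTheory.restrict_Ioo_eq_restrict_Ioc,
      MeasureTheory.ae_restrict_iff' measurableSet_Ioo]
    exact hle
  have hmono := hF
  rw [← uIcc_of_le hT] at hmono
  have hF'int := hmono.intervalIntegrable_deriv
  have hmeas : MeasureTheory.AEStronglyMeasurable (fun s => L (Y s) (u s))
      (MeasureTheory.volume.restrict (Ioc 0 T)) := by
    have h1 : AEMeasurable Y (MeasureTheory.volume.restrict (Ioc 0 T)) := by
      have := hac.continuousOn
      rw [uIcc_of_le hT] at this
      exact (this.mono Ioc_subset_Icc_self).aemeasurable measurableSet_Ioc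
    have h2 : AEMeasurable u (MeasureTheory.volume.restrict (Ioc 0 T)) :=
      (huint.aestronglyMeasurable).aemeasurable
    exact (hLlsc.measurable.comp_aemeasurable (h1.prodMk h2)).aestronglyMeasurable
  have hLint : IntervalIntegrable (fun s => L (Y s) (u s)) MeasureTheory.volume 0 T := by
    rw [intervalIntegrable_iff_integrableOn_Ioc_of_le hT] at hF'int ⊢
    refine MeasureTheory.Integrable.mono' hF'int hmeas ?_
    filter_upwards [hae'] with s hs
    rwa [Real.norm_of_nonneg (hL0 _ _)]
  refine ⟨u, huint, hYu, hLint, ?_⟩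
  have h1 : ∫ s in (0:ℝ)..T, L (Y s) (u s) ≤ ∫ s in (0:ℝ)..T, deriv F s := by
    rw [intervalIntegral.integral_of_le hT, intervalIntegral.integral_of_le hT]
    rw [intervalIntegrable_iff_integrableOn_Ioc_of_le hT] at hF'int hLint
    exact MeasureTheory.integral_mono_ae hLint hF'int hae'
  have h2 := hmono.intervalIntegral_deriv_mem_uIcc
  have hF0 : F 0 ≤ F T := hF (by simp [hT]) (by simp [hT]) hT
  rw [uIcc_of_le (by linarith)] at h2
  exact h1.trans h2.2

lemma EReal.exists_real_of_add_coe_le {a : EReal} {q g : ℝ} (ha : 0 ≤ a)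
    (h : a + (q : EReal) ≤ (g : EReal)) : ∃ w : ℝ, a = w ∧ 0 ≤ w ∧ w + q ≤ g := by
  induction a with
  | bot => simp at ha
  | top => simp at h
  | coe w => exact ⟨w, rfl, by exact_mod_cast ha, by exact_mod_cast h⟩

/-- The weighted squared Euclidean distance on space-time. -/
def quadPenalty {n : ℕ} (lam : ℝ) (z c : ℝ × Euc n) : ℝ :=
  lam * ((z.1 - c.1) ^ 2 + ‖z.2 - c.2‖ ^ 2)

lemma quadPenalty_nonneg {n : ℕ} {lam : ℝ} (hlam : 0 ≤ lam) (z c : ℝ × Euc n) :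
    0 ≤ quadPenalty lam z c := by
  unfold quadPenalty; positivity

lemma exists_quadPenalty_minimizer {n : ℕ} {W : ℝ × Euc n → EReal} (hW0 : ∀ q, 0 ≤ W q)
    (hWlsc : LowerSemicontinuousOn W {q : ℝ × Euc n | 0 ≤ q.1}) {lam : ℝ} (hlam : 0 < lam)
    (c : ℝ × Euc n) {z₀ : ℝ × Euc n} (hz₀ : 0 ≤ z₀.1) {w₀ : ℝ} (hw₀ : W z₀ = w₀) :
    ∃ z : ℝ × Euc n, 0 ≤ z.1 ∧ ∀ z' : ℝ × Euc n, 0 ≤ z'.1 →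
      W z + (quadPenalty lam z c : EReal) ≤ W z' + (quadPenalty lam z' c : EReal) := by
  set G : ℝ := w₀ + quadPenalty lam z₀ c with hG
  have hcont : Continuous (fun z : ℝ × Euc n => quadPenalty lam z c) := by
    unfold quadPenalty; fun_prop
  have hcont' : Continuous (fun z : ℝ × Euc n => (quadPenalty lam z c : EReal)) :=
    continuous_coe_real_ereal.comp hcont
  set S : Set (ℝ × Euc n) := {z | 0 ≤ z.1} ∩ {z | quadPenalty lam z c ≤ G} with hS
  have hw₀0 : 0 ≤ w₀ := by have := hW0 z₀; rw [hw₀] at this; exact_mod_cast this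
  have hcl : IsClosed S :=
    (isClosed_le continuous_const continuous_fst).inter (isClosed_le hcont continuous_const)
  have hbd : S ⊆ closedBall c (G / lam + 1) := by
    rintro z ⟨-, hz⟩
    have h1 : (z.1 - c.1) ^ 2 + ‖z.2 - c.2‖ ^ 2 ≤ G / lam := by
      rw [le_div_iff₀ hlam, mul_comm]; exact hz
    rw [mem_closedBall, dist_eq_norm, Prod.norm_def, max_le_iff]
    constructor
    · rw [Prod.fst_sub, Real.norm_eq_abs]
      nlinarith [sq_abs (z.1 - c.1), sq_nonneg (|z.1 - c.1| - 1), sq_nonneg ‖z.2 - c.2‖]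
    · rw [Prod.snd_sub]
      nlinarith [sq_nonneg (‖z.2 - c.2‖ - 1), sq_nonneg (z.1 - c.1)]
  have hcomp : IsCompact S := (isCompact_closedBall _ _).of_isClosed_subset hcl hbd
  have hlsc : LowerSemicontinuousOn (fun z => W z + (quadPenalty lam z c : EReal)) S := by
    refine LowerSemicontinuousOn.add' (fun z hz => (hWlsc z hz.1).mono inter_subset_left)
      (hcont'.lowerSemicontinuous.lowerSemicontinuousOn S) fun z _ => ?_
    exact EReal.continuousAt_add (Or.inr (EReal.coe_ne_bot _)) (Or.inr (EReal.coe_ne_top _))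
  have hz₀S : z₀ ∈ S := ⟨hz₀, by simp [hG, hw₀0]⟩
  obtain ⟨z, hz, hmin⟩ := hlsc.exists_isMinOn ⟨z₀, hz₀S⟩ hcomp
  refine ⟨z, hz.1, fun z' hz' => ?_⟩
  by_cases h : quadPenalty lam z' c ≤ G
  · exact hmin (show z' ∈ S from ⟨hz', h⟩)
  · have h1 : W z + (quadPenalty lam z c : EReal) ≤ (G : EReal) := by
      have := hmin hz₀S
      simpa [hw₀, hG] using this
    calc W z + (quadPenalty lam z c : EReal) ≤ (G : EReal) := h1
      _ ≤ (quadPenalty lam z' c : EReal) := by exact_mod_cast (not_le.1 h).le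
      _ ≤ _ := le_add_of_nonneg_left (hW0 z')

/-- At a minimizer of a quadratically penalized function, the gradient of the penalty is a
subgradient. -/
lemma mem_subdiffP_of_quadPenalty_min {n : ℕ} {W : ℝ × Euc n → EReal} {lam : ℝ} (hlam : 0 < lam)
    {c z : ℝ × Euc n} (hz : 0 < z.1) {w : ℝ} (hw : W z = w) (hW0 : ∀ q, 0 ≤ W q)
    (hmin : ∀ z' : ℝ × Euc n, 0 ≤ z'.1 →
      W z + (quadPenalty lam z c : EReal) ≤ W z' + (quadPenalty lam z' c : EReal)) :
    (2 * lam * (c.1 - z.1), (2 * lam) • (c.2 - z.2)) ∈ subdiffP W z := by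
  intro ε hε
  have h1 : ∀ᶠ z' : ℝ × Euc n in 𝓝 z, 0 < z'.1 :=
    continuous_fst.continuousAt.eventually (lt_mem_nhds hz)
  have h2 : ∀ᶠ z' : ℝ × Euc n in 𝓝 z, dist z' z < ε / (2 * lam) :=
    Metric.eventually_nhds_iff.2 ⟨_, by positivity, fun _ h => h⟩
  filter_upwards [h1, h2] with z' h1 h2
  have hm := hmin z' h1.le
  rw [hw] at hm ⊢
  rcases eq_or_ne (W z') ⊤ with ht | ht
  · rw [ht]; exact le_top
  lift W z' to ℝ using ⟨ht, fun hb => by have := hW0 z'; rw [hb] at this; simp at this⟩ with w'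
  norm_cast at hm ⊢
  rw [dist_eq_norm, lt_div_iff₀ (by positivity)] at h2
  have h3 : (z'.1 - z.1) ^ 2 ≤ ‖z' - z‖ ^ 2 := by
    rw [← sq_abs]
    exact pow_le_pow_left₀ (abs_nonneg _) (norm_fst_le (z' - z)) 2
  have h4 : ‖z'.2 - z.2‖ ^ 2 ≤ ‖z' - z‖ ^ 2 :=
    pow_le_pow_left₀ (norm_nonneg _) (norm_snd_le (z' - z)) 2
  have h5 : ‖z'.2 - c.2‖ ^ 2 =
      ‖z.2 - c.2‖ ^ 2 - 2 * ⟪c.2 - z.2, z'.2 - z.2⟫ + ‖z'.2 - z.2‖ ^ 2 := by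
    have : z'.2 - c.2 = (z'.2 - z.2) - (c.2 - z.2) := by abel
    rw [this, norm_sub_sq_real, real_inner_comm, norm_sub_rev c.2 z.2]; ring
  have h6 : lam * ((z'.1 - z.1) ^ 2 + ‖z'.2 - z.2‖ ^ 2) ≤ ε * ‖z' - z‖ := by
    have := mul_le_mul_of_nonneg_right h2.le (norm_nonneg (z' - z))
    nlinarith
  unfold quadPenalty at hm
  rw [h5] at hm
  simp only [real_inner_smul_left]
  nlinarith

/-- Moving the centre of the penalty along a suitable velocity for a short time decreases the
penalized value at a rate arbitrarily close to the running cost. -/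
lemma exists_descent_velocity {n : ℕ} {L : Euc n → Euc n → ℝ} {Θ : Euc n → ℝ}
    {W : ℝ × Euc n → EReal}
    (hΘ0 : ∀ u, 0 ≤ Θ u) (hΘ : Superlinear Θ) (hcoer : ∀ x u, Θ u ≤ L x u)
    (hW0 : ∀ q, 0 ≤ W q)
    (hsuper : ∀ t : ℝ, ∀ x : Euc n, 0 < t → ∀ p ∈ subdiffP W (t, x),
      (0 : EReal) ≤ (p.1 : ℝ) + Ham L x (-p.2))
    {lam : ℝ} (hlam : 0 < lam) {B : ℝ} (hB : 0 ≤ B) {η : ℝ} (hη : 0 < η) :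
    ∃ h₀ > 0, ∀ (c z : ℝ × Euc n) (g : ℝ), 0 < z.1 →
      (∀ z' : ℝ × Euc n, 0 ≤ z'.1 →
        W z + (quadPenalty lam z c : EReal) ≤ W z' + (quadPenalty lam z' c : EReal)) →
      W z + (quadPenalty lam z c : EReal) ≤ (g : EReal) → g ≤ B →
      ∃ u : Euc n, ∀ h : ℝ, 0 ≤ h → h ≤ h₀ →
        W z + (quadPenalty lam z (c.1 - h, c.2 + h • u) : EReal) ≤
          ((g - h * L z.2 u + h * η : ℝ) : EReal) := by
  set P : ℝ := 2 * lam * (B / lam + 1) with hP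
  have hP0 : 0 ≤ P := by positivity
  obtain ⟨K, hK0, hK⟩ := hΘ.exists_affine_norm_le hΘ0 (M := P + 1) (by positivity)
  set R : ℝ := P + η / 2 + K with hR
  have hR0 : 0 ≤ R := by positivity
  refine ⟨η / (2 * lam * (1 + R ^ 2)), by positivity, fun c z g hz hmin hg hgB => ?_⟩
  obtain ⟨w, hw, hw0, hwg⟩ := EReal.exists_real_of_add_coe_le (hW0 z) hg
  have hsub := mem_subdiffP_of_quadPenalty_min hlam hz hw hW0 hmin
  have hH := hsuper z.1 z.2 hz _ hsub
  simp only at hH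
  set p1 : ℝ := 2 * lam * (c.1 - z.1) with hp1
  set p2 : Euc n := (2 * lam) • (c.2 - z.2) with hp2
  have hsq : (z.1 - c.1) ^ 2 + ‖z.2 - c.2‖ ^ 2 ≤ B / lam := by
    rw [le_div_iff₀ hlam, mul_comm]
    have : quadPenalty lam z c ≤ B := by linarith
    exact this
  have hp1P : p1 ≤ P := by
    refine mul_le_mul_of_nonneg_left ?_ (by positivity)
    nlinarith [sq_nonneg (c.1 - z.1 - 1), sq_nonneg ‖z.2 - c.2‖]
  have hp2P : ‖p2‖ ≤ P := by
    rw [hp2, norm_smul, Real.norm_of_nonneg (by positivity), norm_sub_rev]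
    refine mul_le_mul_of_nonneg_left ?_ (by positivity)
    nlinarith [sq_nonneg (‖z.2 - c.2‖ - 1), sq_nonneg (z.1 - c.1)]
  obtain ⟨u, hu⟩ : ∃ u, L z.2 u ≤ p1 - ⟪p2, u⟫ + η / 2 := by
    have h1 : ((-p1 - η / 2 : ℝ) : EReal) < Ham L z.2 (-p2) := by
      by_contra! hcon
      have h2 := hH.trans (add_le_add_right hcon (p1 : EReal))
      have h3 : 0 ≤ p1 + (-p1 - η / 2) := by exact_mod_cast h2
      linarith
    obtain ⟨u, hu⟩ := lt_iSup_iff.1 h1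
    refine ⟨u, ?_⟩
    have : -p1 - η / 2 < ⟪-p2, u⟫ - L z.2 u := by exact_mod_cast hu
    rw [inner_neg_left] at this
    linarith
  have huR : ‖u‖ ≤ R := by
    have h1 := hK u
    have h2 := hcoer z.2 u
    have h3 := abs_le.1 (abs_real_inner_le_norm p2 u)
    have h4 := mul_le_mul_of_nonneg_right hp2P (norm_nonneg u)
    nlinarith
  refine ⟨u, fun h hh0 hh => ?_⟩
  rw [le_div_iff₀ (by positivity)] at hh
  have hexp : quadPenalty lam z (c.1 - h, c.2 + h • u) =
      quadPenalty lam z c + h * (-p1 + ⟪p2, u⟫) + lam * h ^ 2 * (1 + ‖u‖ ^ 2) := by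
    have h1 : ‖z.2 - (c.2 + h • u)‖ ^ 2 =
        ‖z.2 - c.2‖ ^ 2 + 2 * h * ⟪c.2 - z.2, u⟫ + h ^ 2 * ‖u‖ ^ 2 := by
      rw [norm_sub_rev, show c.2 + h • u - z.2 = (c.2 - z.2) + h • u by abel, norm_add_sq_real,
        norm_sub_rev, real_inner_smul_right, norm_smul, mul_pow, Real.norm_eq_abs, sq_abs]
      ring
    unfold quadPenalty
    simp only [h1, hp1, hp2, real_inner_smul_left]
    ring
  have hu2 : ‖u‖ ^ 2 ≤ R ^ 2 := pow_le_pow_left₀ (norm_nonneg u) huR 2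
  have herr : lam * h ^ 2 * (1 + ‖u‖ ^ 2) ≤ h * (η / 2) := by
    have h1 : lam * h ^ 2 * (1 + ‖u‖ ^ 2) ≤ lam * h ^ 2 * (1 + R ^ 2) := by gcongr
    nlinarith
  have hdec : h * (-p1 + ⟪p2, u⟫) ≤ h * (η / 2 - L z.2 u) :=
    mul_le_mul_of_nonneg_left (by linarith) hh0
  rw [hw]
  norm_cast
  rw [hexp]
  linarith

lemma exists_seq_of_exists_step {α : Type*} (P : ℕ → α → Prop) (R : ℕ → α → α → Prop) {a₀ : α}
    (h₀ : P 0 a₀) (step : ∀ i a, P i a → ∃ b, P (i + 1) b ∧ R i a b) :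
    ∃ f : ℕ → α, f 0 = a₀ ∧ ∀ i, P i (f i) ∧ R i (f i) (f (i + 1)) := by
  choose nxt hnxt using step
  let g : (i : ℕ) → {a // P i a} := fun i =>
    Nat.rec ⟨a₀, h₀⟩ (fun i a => ⟨nxt i a.1 a.2, (hnxt i a.1 a.2).1⟩) i
  exact ⟨fun i => (g i).1, rfl, fun i => ⟨(g i).2, (hnxt i (g i).1 (g i).2).2⟩⟩

/-- Discrete descent for a supersolution: an Euler polygon along which the supersolution plus the
accumulated cost does not increase by more than `δ`. -/
lemma exists_discrete_descent {n : ℕ} {L : Euc n → Euc n → ℝ} {Θ : Euc n → ℝ}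
    {W : ℝ × Euc n → EReal} (hL0 : ∀ x u, 0 ≤ L x u)
    (hΘ0 : ∀ u, 0 ≤ Θ u) (hΘ : Superlinear Θ) (hcoer : ∀ x u, Θ u ≤ L x u)
    (hW0 : ∀ q, 0 ≤ W q)
    (hWlsc : LowerSemicontinuousOn W {q : ℝ × Euc n | 0 ≤ q.1})
    (hsuper : ∀ t : ℝ, ∀ x : Euc n, 0 < t → ∀ p ∈ subdiffP W (t, x),
      (0 : EReal) ≤ (p.1 : ℝ) + Ham L x (-p.2))
    {T : ℝ} (hT : 0 < T) {x₀ : Euc n} {w₀ : ℝ} (hw₀ : W (T, x₀) = w₀) {δ : ℝ} (hδ : 0 < δ) :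
    ∃ (N : ℕ) (Y : ℕ → Euc n) (C : ℕ → ℝ), 0 < N ∧ T / N ≤ δ ∧ Y 0 = x₀ ∧ C 0 = 0 ∧
      (∀ i < N, (∃ x' u, ‖x' - Y i‖ ≤ δ ∧ Y (i + 1) = Y i + (T / N) • u ∧
          C (i + 1) = C i + T / N * L x' u) ∨
        (T - δ ≤ i * (T / N) ∧ Y (i + 1) = Y i ∧ C (i + 1) = C i)) ∧
      ∃ z : ℝ × Euc n, 0 ≤ z.1 ∧ z.1 ≤ δ ∧ ‖z.2 - Y N‖ ≤ δ ∧
        W z + (C N : EReal) ≤ ((w₀ + δ : ℝ) : EReal) := by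
  have hw₀0 : 0 ≤ w₀ := by have := hW0 (T, x₀); rw [hw₀] at this; exact_mod_cast this
  set lam : ℝ := (w₀ + δ) / (δ / 2) ^ 2 with hlam_def
  have hlam : 0 < lam := by positivity
  have hlamδ : lam * (δ / 2) ^ 2 = w₀ + δ := by rw [hlam_def]; field_simp
  have hclose : ∀ z c : ℝ × Euc n, quadPenalty lam z c ≤ w₀ + δ →
      |z.1 - c.1| ≤ δ / 2 ∧ ‖z.2 - c.2‖ ≤ δ / 2 := by
    intro z c h
    rw [← hlamδ] at h
    have h1 : (z.1 - c.1) ^ 2 + ‖z.2 - c.2‖ ^ 2 ≤ (δ / 2) ^ 2 := le_of_mul_le_mul_left h hlam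
    refine ⟨abs_le_of_sq_le_sq ?_ (by positivity), ?_⟩
    · nlinarith [sq_nonneg ‖z.2 - c.2‖]
    · refine le_of_sq_le_sq ?_ (by positivity)
      nlinarith [sq_nonneg (z.1 - c.1)]
  set η : ℝ := δ / T with hη_def
  have hη : 0 < η := by positivity
  obtain ⟨h₀, hh₀, hdesc⟩ := exists_descent_velocity hΘ0 hΘ hcoer hW0 hsuper hlam
    (show 0 ≤ w₀ + δ by positivity) hη
  obtain ⟨N, hN⟩ := exists_nat_gt (T / min h₀ δ)
  have hmin0 : 0 < min h₀ δ := lt_min hh₀ hδ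
  have hN0 : (0 : ℝ) < N := lt_trans (by positivity) hN
  set h : ℝ := T / N with hh_def
  have hh : 0 < h := by positivity
  have hNh : N * h = T := by rw [hh_def]; field_simp
  have hhmin : h ≤ min h₀ δ := by
    rw [div_lt_iff₀ hmin0] at hN
    rw [hh_def, div_le_iff₀ hN0]; linarith
  let P : ℕ → ℝ × Euc n × ℝ → Prop := fun i a => i ≤ N →
    T - i * h ≤ a.1 ∧ (a.1 = T - i * h ∨ a.1 ≤ δ / 2) ∧ 0 ≤ a.2.2 ∧
      ∃ z : ℝ × Euc n, 0 ≤ z.1 ∧ W z + (quadPenalty lam z (a.1, a.2.1) : EReal) ≤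
        ((w₀ + i * (h * η) - a.2.2 : ℝ) : EReal)
  let R : ℕ → ℝ × Euc n × ℝ → ℝ × Euc n × ℝ → Prop := fun i a b => i < N →
    (∃ x' u, ‖x' - a.2.1‖ ≤ δ ∧ b.2.1 = a.2.1 + h • u ∧ b.2.2 = a.2.2 + h * L x' u) ∨
      (T - δ ≤ i * h ∧ b.2.1 = a.2.1 ∧ b.2.2 = a.2.2)
  have hgB : ∀ i : ℕ, i ≤ N → ∀ C : ℝ, 0 ≤ C → w₀ + i * (h * η) - C ≤ w₀ + δ := by
    intro i hi C hC
    have h1 : (i : ℝ) * (h * η) ≤ N * (h * η) :=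
      mul_le_mul_of_nonneg_right (by exact_mod_cast hi) (by positivity)
    have h2 : N * (h * η) = δ := by rw [← mul_assoc, hNh, hη_def]; field_simp
    linarith
  have hP0 : P 0 (T, x₀, 0) := by
    intro _
    refine ⟨by simp, Or.inl (by simp), le_rfl, (T, x₀), hT.le, ?_⟩
    simp [quadPenalty, hw₀]
  have hstep : ∀ i a, P i a → ∃ b, P (i + 1) b ∧ R i a b := by
    rintro i ⟨s, y, C⟩ hPa
    by_cases hi : i < N
    swap
    · exact ⟨(s, y, C), fun h => absurd h (by omega), fun h => absurd h hi⟩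
    obtain ⟨ha1, ha2, ha3, z₁, hz₁, hz₁g⟩ := hPa hi.le
    simp only at ha1 ha2 ha3 hz₁g
    obtain ⟨z, hz, hzmin⟩ := exists_quadPenalty_minimizer hW0 hWlsc hlam (s, y) hT.le hw₀
    have hzg := (hzmin z₁ hz₁).trans hz₁g
    have hB := hgB i hi.le C ha3
    obtain ⟨w, hw, hw0, hwg⟩ := EReal.exists_real_of_add_coe_le (hW0 z) hzg
    obtain ⟨hcl1, hcl2⟩ := hclose z (s, y) (by linarith)
    simp only at hcl1 hcl2
    rcases hz.eq_or_lt with hz0 | hz0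
    · rw [← hz0, zero_sub, abs_neg] at hcl1
      have hs : s ≤ δ / 2 := (le_abs_self s).trans hcl1
      refine ⟨(s, y, C), fun _ => ⟨?_, Or.inr hs, ha3, z, hz, hzg.trans ?_⟩,
        fun _ => Or.inr ⟨by linarith, rfl, rfl⟩⟩
      · push_cast; nlinarith
      · norm_cast; push_cast; nlinarith [mul_pos hh hη]
    · obtain ⟨u, hu⟩ := hdesc (s, y) z _ hz0 hzmin hzg hB
      have hu' := hu h hh.le (hhmin.trans (min_le_left _ _))
      refine ⟨(s - h, y + h • u, C + h * L z.2 u), fun _ => ⟨?_, ?_, ?_, z, hz, hu'.trans ?_⟩,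
        fun _ => Or.inl ⟨z.2, u, by linarith, rfl, rfl⟩⟩
      · push_cast; linarith
      · rcases ha2 with h | h
        · left; push_cast; linarith
        · right; linarith
      · have := hL0 z.2 u
        positivity
      · norm_cast; push_cast; linarith
  obtain ⟨f, hf0, hf⟩ := exists_seq_of_exists_step P R hP0 hstep
  refine ⟨N, fun i => (f i).2.1, fun i => (f i).2.2, by exact_mod_cast hN0,
    hhmin.trans (min_le_right _ _), by simp [hf0], by simp [hf0], fun i hi => (hf i).2 hi, ?_⟩
  obtain ⟨h1, h2, h3, z, hz, hzg⟩ := (hf N).1 le_rfl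
  obtain ⟨w, hw, hw0, hwg⟩ := EReal.exists_real_of_add_coe_le (hW0 z) hzg
  have hB := hgB N le_rfl _ h3
  obtain ⟨hcl1, hcl2⟩ := hclose z _ (by linarith)
  have hq := quadPenalty_nonneg hlam.le z ((f N).1, (f N).2.1)
  have hB' := hgB N le_rfl 0 le_rfl
  refine ⟨z, hz, ?_, by simp only at hcl2; linarith, ?_⟩
  · have hs : (f N).1 ≤ δ / 2 := by
      rcases h2 with h | h
      · rw [h, hNh]; linarith
      · exact h
    have := (abs_le.1 hcl1).2
    simp only at this
    linarith
  · rw [hw]; norm_cast; linarith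

/-- Approximate descent curves: piecewise constant curves, with accumulated cost `F`, which
satisfy up to `δ` all the affine lower bounds valid for the running cost. -/
lemma exists_approximate_descent {n : ℕ} {L : Euc n → Euc n → ℝ} {Θ : Euc n → ℝ}
    {W : ℝ × Euc n → EReal} (hL0 : ∀ x u, 0 ≤ L x u)
    (hΘ0 : ∀ u, 0 ≤ Θ u) (hΘ : Superlinear Θ) (hcoer : ∀ x u, Θ u ≤ L x u)
    (hW0 : ∀ q, 0 ≤ W q)
    (hWlsc : LowerSemicontinuousOn W {q : ℝ × Euc n | 0 ≤ q.1})
    (hsuper : ∀ t : ℝ, ∀ x : Euc n, 0 < t → ∀ p ∈ subdiffP W (t, x),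
      (0 : EReal) ≤ (p.1 : ℝ) + Ham L x (-p.2))
    {T : ℝ} (hT : 0 < T) {x₀ : Euc n} {w₀ : ℝ} (hw₀ : W (T, x₀) = w₀) {δ : ℝ} (hδ : 0 < δ) :
    ∃ (y : ℝ → Euc n) (F : ℝ → ℝ) (z : ℝ × Euc n), y 0 = x₀ ∧ F 0 = 0 ∧
      MonotoneOn F (Icc 0 T) ∧
      (∀ (p : Euc n) (c r : ℝ) (x₁ : Euc n) (a b : ℝ), 0 ≤ a → a ≤ b → b ≤ T - δ →
        (∀ x', ‖x' - x₁‖ < r → ∀ u, ⟪p, u⟫ + c ≤ L x' u) →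
        (∀ τ ∈ Icc a b, ‖y τ - x₁‖ + δ < r) →
        ⟪p, y b - y a⟫ + c * (b - a) ≤ F b - F a + |c| * δ) ∧
      (∀ M K : ℝ, 0 ≤ M → 0 ≤ K → (∀ x' u, M * ‖u‖ - K ≤ L x' u) →
        ∀ a b : ℝ, 0 ≤ a → a ≤ b → b ≤ T →
        M * dist (y a) (y b) ≤ F b - F a + K * (b - a) + K * δ) ∧
      0 ≤ z.1 ∧ z.1 ≤ δ ∧ ‖z.2 - y T‖ ≤ δ ∧ W z + (F T : EReal) ≤ ((w₀ + δ : ℝ) : EReal) := by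
  obtain ⟨N, Y, C, hN, hhδ, hY0, hC0, hstep, z, hz0, hzδ, hzY, hzW⟩ :=
    exists_discrete_descent hL0 hΘ0 hΘ hcoer hW0 hWlsc hsuper hT hw₀ hδ
  have hN0 : (0 : ℝ) < N := by exact_mod_cast hN
  set h : ℝ := T / N with hh_def
  have hh : 0 < h := by positivity
  have hfloorT : ⌊T / h⌋₊ = N := by
    rw [show T / h = N by rw [hh_def]; field_simp, Nat.floor_natCast]
  have hfloork : ∀ k : ℕ, ⌊(k * h) / h⌋₊ = k := fun k => by
    rw [mul_div_cancel_right₀ _ hh.ne', Nat.floor_natCast]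
  have hmono : ∀ a b : ℝ, a ≤ b → ⌊a / h⌋₊ ≤ ⌊b / h⌋₊ := fun a b hab => by gcongr
  have hlo : ∀ a : ℝ, 0 ≤ a → ⌊a / h⌋₊ * h ≤ a := fun a ha => by
    rw [← le_div_iff₀ hh]; exact Nat.floor_le (by positivity)
  have hup : ∀ a : ℝ, a < ⌊a / h⌋₊ * h + h := fun a => by
    have := Nat.lt_floor_add_one (a / h)
    rw [div_lt_iff₀ hh] at this; linarith
  have hleN : ∀ b : ℝ, b ≤ T → ⌊b / h⌋₊ ≤ N := fun b hb => hfloorT ▸ hmono b T hb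
  have hCmono : ∀ i j : ℕ, i ≤ j → j ≤ N → C i ≤ C j := by
    intro i j hij
    induction j, hij using Nat.le_induction with
    | base => intro _; exact le_rfl
    | succ k hk ih =>
      intro hkN
      refine (ih (by omega)).trans ?_
      rcases hstep k (by omega) with ⟨x', u, -, -, hCk⟩ | ⟨-, -, hCk⟩
      · have := mul_nonneg hh.le (hL0 x' u); linarith
      · exact hCk.ge
  refine ⟨fun τ => Y ⌊τ / h⌋₊, fun τ => C ⌊τ / h⌋₊, z, by simp [hY0], by simp [hC0], ?_, ?_, ?_,
    hz0, hzδ, by simpa only [hfloorT] using hzY, by simpa only [hfloorT] using hzW⟩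
  · intro a _ b hb hab
    exact hCmono _ _ (hmono a b hab) (hleN b hb.2)
  · intro p c r x₁ a b ha hab hb hL hy
    have hkey : ∀ k : ℕ, ⌊a / h⌋₊ ≤ k → k ≤ ⌊b / h⌋₊ →
        ⟪p, Y k - Y ⌊a / h⌋₊⟫ + c * ((k - ⌊a / h⌋₊) * h) ≤ C k - C ⌊a / h⌋₊ := by
      intro k hk
      induction k, hk using Nat.le_induction with
      | base => intro _; simp
      | succ k hk ih =>
        intro hkb
        have ih := ih (by omega)
        have hkb' : ((k : ℝ) + 1) * h ≤ b := by
          refine le_trans ?_ (hlo b (ha.trans hab))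
          gcongr
          exact_mod_cast hkb
        have hnear : ‖Y k - x₁‖ + δ < r := by
          rcases hk.eq_or_lt with rfl | hk'
          · exact hy a ⟨le_rfl, hab⟩
          · have h1 : a ≤ k * h := by
              refine (hup a).le.trans ?_
              have : ((⌊a / h⌋₊ : ℝ) + 1) * h ≤ k * h := by gcongr; exact_mod_cast hk'
              linarith
            have := hy (k * h) ⟨h1, by linarith⟩
            simpa only [hfloork k] using this
        rcases hstep k (lt_of_lt_of_le hkb (hleN b (by linarith))) with
          ⟨x', u, hx', hYk, hCk⟩ | ⟨hlate, -, -⟩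
        · have hx'' : ‖x' - x₁‖ < r := by
            have := norm_sub_le_norm_sub_add_norm_sub x' (Y k) x₁
            linarith
          have h1 := mul_le_mul_of_nonneg_left (hL x' hx'' u) hh.le
          have h2 : Y (k + 1) - Y ⌊a / h⌋₊ = (Y k - Y ⌊a / h⌋₊) + h • u := by rw [hYk]; abel
          rw [h2, inner_add_right, real_inner_smul_right, hCk]
          push_cast
          linarith
        · linarith
    have h1 := hkey _ (hmono a b hab) le_rfl
    have h2 : |(b - a) - ((⌊b / h⌋₊ : ℝ) - ⌊a / h⌋₊) * h| ≤ δ := by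
      have := hlo a ha
      have := hlo b (ha.trans hab)
      have := hup a
      have := hup b
      rw [abs_le]
      constructor <;> linarith
    have h3 := le_abs_self (c * ((b - a) - ((⌊b / h⌋₊ : ℝ) - ⌊a / h⌋₊) * h))
    rw [abs_mul] at h3
    have h4 := mul_le_mul_of_nonneg_left h2 (abs_nonneg c)
    simp only
    linarith
  · intro M K hM hK hL a b ha hab hb
    have hkey : ∀ k : ℕ, ⌊a / h⌋₊ ≤ k → k ≤ N →
        M * dist (Y ⌊a / h⌋₊) (Y k) ≤ C k - C ⌊a / h⌋₊ + K * ((k - ⌊a / h⌋₊) * h) := by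
      intro k hk
      induction k, hk using Nat.le_induction with
      | base => intro _; simp
      | succ k hk ih =>
        intro hkN
        have ih := ih (by omega)
        have htri := mul_le_mul_of_nonneg_left (dist_triangle (Y ⌊a / h⌋₊) (Y k) (Y (k + 1))) hM
        have hKh : 0 ≤ K * h := by positivity
        rcases hstep k (by omega) with ⟨x', u, -, hYk, hCk⟩ | ⟨-, hYk, hCk⟩
        · have h1 := mul_le_mul_of_nonneg_left (hL x' u) hh.le
          have h2 : dist (Y k) (Y (k + 1)) = h * ‖u‖ := by
            rw [hYk, dist_self_add_right, norm_smul, Real.norm_of_nonneg hh.le]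
          rw [h2] at htri
          push_cast
          linarith
        · rw [hYk, hCk]
          push_cast
          linarith
    have h1 := hkey _ (hmono a b hab) (hleN b hb)
    have h2 : ((⌊b / h⌋₊ : ℝ) - ⌊a / h⌋₊) * h ≤ (b - a) + δ := by
      have := hlo b (ha.trans hab)
      have := hup a
      linarith
    have h3 := mul_le_mul_of_nonneg_left h2 hK
    simp only
    linarith

/-- A supersolution is bounded below by the cost of some admissible trajectory. -/
lemma exists_control_of_supersolution {n : ℕ} {L : Euc n → Euc n → ℝ} {Θ : Euc n → ℝ}
    {W : ℝ × Euc n → EReal} (hL0 : ∀ x u, 0 ≤ L x u)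
    (hLlsc : LowerSemicontinuous (fun q : Euc n × Euc n => L q.1 q.2))
    (hconv : ∀ x, ConvexOn ℝ Set.univ (L x))
    (hΘ0 : ∀ u, 0 ≤ Θ u) (hΘ : Superlinear Θ) (hcoer : ∀ x u, Θ u ≤ L x u)
    (hW0 : ∀ q, 0 ≤ W q)
    (hWlsc : LowerSemicontinuousOn W {q : ℝ × Euc n | 0 ≤ q.1})
    (hsuper : ∀ t : ℝ, ∀ x : Euc n, 0 < t → ∀ p ∈ subdiffP W (t, x),
      (0 : EReal) ≤ (p.1 : ℝ) + Ham L x (-p.2))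
    {T : ℝ} (hT : 0 < T) {x₀ : Euc n} {w₀ : ℝ} (hw₀ : W (T, x₀) = w₀) :
    ∃ (Y u : ℝ → Euc n), IntervalIntegrable u MeasureTheory.volume 0 T ∧
      (∀ s ∈ Icc 0 T, x₀ + ∫ τ in (0:ℝ)..s, u τ = Y s) ∧
      IntervalIntegrable (fun s => L (Y s) (u s)) MeasureTheory.volume 0 T ∧
      ((∫ s in (0:ℝ)..T, L (Y s) (u s) : ℝ) : EReal) + W (0, Y T) ≤ w₀ := by
  have hδpos : ∀ k : ℕ, (0 : ℝ) < 1 / (k + 1) := fun k => Nat.one_div_pos_of_nat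
  have hδ1 : ∀ k : ℕ, (1 : ℝ) / (k + 1) ≤ 1 := fun k => by
    rw [div_le_one (by positivity)]; linarith [(Nat.cast_nonneg k : (0 : ℝ) ≤ k)]
  choose y F z hy0 hF0 hFmono hB hC hz0 hzδ hzy hzW using fun k : ℕ =>
    exists_approximate_descent hL0 hΘ0 hΘ hcoer hW0 hWlsc hsuper hT hw₀ (hδpos k)
  set δ : ℕ → ℝ := fun k => 1 / (k + 1) with hδ_def
  let 𝒰 : Ultrafilter ℕ := hyperfilter ℕ
  have hδ0 : Tendsto δ 𝒰 (𝓝 0) :=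
    tendsto_one_div_add_atTop_nhds_zero_nat.mono_left Nat.hyperfilter_le_atTop
  have hw₀0 : 0 ≤ w₀ := by have := hW0 (T, x₀); rw [hw₀] at this; exact_mod_cast this
  have h0mem : (0 : ℝ) ∈ Icc 0 T := ⟨le_rfl, hT.le⟩
  have hTmem : T ∈ Icc 0 T := ⟨hT.le, le_rfl⟩
  have hFT : ∀ k, F k T ≤ w₀ + 1 := fun k => by
    obtain ⟨w, -, hw0, hw⟩ := EReal.exists_real_of_add_coe_le (hW0 (z k)) (hzW k)
    linarith [hδ1 k]
  have hFmem : ∀ k, ∀ τ ∈ Icc 0 T, F k τ ∈ Icc 0 (w₀ + 1) := fun k τ hτ =>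
    ⟨(hF0 k).symm.le.trans (hFmono k h0mem hτ hτ.1), (hFmono k hτ hTmem hτ.2).trans (hFT k)⟩
  have hLM : ∀ M : ℝ, 0 ≤ M → ∃ K : ℝ, 0 ≤ K ∧ ∀ x' u, M * ‖u‖ - K ≤ L x' u := fun M hM => by
    obtain ⟨K, hK0, hK⟩ := hΘ.exists_affine_norm_le hΘ0 hM
    exact ⟨K, hK0, fun x' u => (hK u).trans (hcoer x' u)⟩
  have hΦex : ∀ τ, ∃ l, τ ∈ Icc 0 T → Tendsto (fun k => F k τ) 𝒰 (𝓝 l) := fun τ => by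
    by_cases hτ : τ ∈ Icc 0 T
    · obtain ⟨l, -, hl⟩ := (isCompact_Icc (a := (0 : ℝ)) (b := w₀ + 1)).ultrafilter_le_nhds
        (𝒰.map fun k => F k τ) (by
          rw [Ultrafilter.coe_map, le_principal_iff, mem_map]
          exact Eventually.of_forall fun k => hFmem k τ hτ)
      exact ⟨l, fun _ => hl⟩
    · exact ⟨0, fun h => absurd h hτ⟩
  have hYex : ∀ τ, ∃ l, τ ∈ Icc 0 T → Tendsto (fun k => y k τ) 𝒰 (𝓝 l) := fun τ => by
    by_cases hτ : τ ∈ Icc 0 T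
    · obtain ⟨K, hK0, hK⟩ := hLM 1 zero_le_one
      obtain ⟨l, -, hl⟩ := (isCompact_closedBall x₀ (w₀ + 1 + K * T + K)).ultrafilter_le_nhds
        (𝒰.map fun k => y k τ) (by
          rw [Ultrafilter.coe_map, le_principal_iff, mem_map]
          refine Eventually.of_forall fun k => ?_
          have h1 := hC k 1 K zero_le_one hK0 hK 0 τ le_rfl hτ.1 hτ.2
          rw [hy0, hF0] at h1
          have h2 := (hFmem k τ hτ).2
          have h3 := mul_le_mul_of_nonneg_left (hδ1 k) hK0
          have h4 := mul_le_mul_of_nonneg_left hτ.2 hK0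
          rw [mem_closedBall, dist_comm]
          linarith)
      exact ⟨l, fun _ => hl⟩
    · exact ⟨0, fun h => absurd h hτ⟩
  choose Φ hΦ using hΦex
  choose Y hY using hYex
  have hY0 : Y 0 = x₀ := by
    refine tendsto_nhds_unique (hY 0 h0mem) ?_
    simp only [hy0]
    exact tendsto_const_nhds
  have hΦ0 : Φ 0 = 0 := by
    refine tendsto_nhds_unique (hΦ 0 h0mem) ?_
    simp only [hF0]
    exact tendsto_const_nhds
  have hΦmono : MonotoneOn Φ (Icc 0 T) := fun a ha b hb hab =>
    le_of_tendsto_of_tendsto' (hΦ a ha) (hΦ b hb) fun k => hFmono k ha hb hab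
  obtain ⟨u, hu, hYu, hLu, hcost⟩ := exists_control_of_affine_minorant_bound hL0 hLlsc hconv hΘ0
    hΘ hcoer hT.le hΦmono (Y := Y) (fun M hM => by
      obtain ⟨K, hK0, hK⟩ := hLM M hM
      refine ⟨K, hK0, fun a b ha hab hb => ?_⟩
      have ha' : a ∈ Icc 0 T := ⟨ha, hab.trans hb⟩
      have hb' : b ∈ Icc 0 T := ⟨ha.trans hab, hb⟩
      have h1 := le_of_tendsto_of_tendsto' (((hY a ha').dist (hY b hb')).const_mul M)
        ((((hΦ b hb').sub (hΦ a ha')).add_const (K * (b - a))).add (hδ0.const_mul K))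
        fun k => hC k M K hM hK0 hK a b ha hab hb
      simpa using h1) (fun s hs p c r hr hL => by
      set M : ℝ := 2 * (w₀ + 3) / r with hM_def
      have hM : 0 < M := by positivity
      obtain ⟨K, hK0, hK⟩ := hLM M hM.le
      refine ⟨min (1 / (K + 1)) ((T - s) / 2),
        lt_min (by positivity) (by linarith [hs.2]), fun b hb => ?_⟩
      have hρ1 : K * (b - s) ≤ 1 := by
        have h1 : b - s ≤ 1 / (K + 1) := by
          linarith [hb.2, min_le_left (1 / (K + 1)) ((T - s) / 2)]
        rw [le_div_iff₀ (by positivity)] at h1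
        nlinarith [hb.1]
      have hρ2 : b ≤ (s + T) / 2 := by
        linarith [hb.2, min_le_right (1 / (K + 1)) ((T - s) / 2)]
      have hsm : s ∈ Icc 0 T := ⟨hs.1.le, hs.2.le⟩
      have hbm : b ∈ Icc 0 T := ⟨hs.1.le.trans hb.1, by linarith [hs.2]⟩
      have hlim := ((((hΦ b hbm).sub (hΦ s hsm))).add (hδ0.const_mul |c|))
      rw [mul_zero, add_zero] at hlim
      have hlim' : Tendsto (fun k => ⟪p, y k b - y k s⟫ + c * (b - s)) 𝒰
          (𝓝 (⟪p, Y b - Y s⟫ + c * (b - s))) :=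
        (tendsto_const_nhds.inner ((hY b hbm).sub (hY s hsm))).add_const _
      refine le_of_tendsto_of_tendsto hlim' hlim ?_
      have e1 : ∀ᶠ k in (𝒰 : Filter ℕ), dist (y k s) (Y s) < r / 4 :=
        (Metric.tendsto_nhds.1 (hY s hsm)) _ (by positivity)
      have e2 : ∀ᶠ k in (𝒰 : Filter ℕ), δ k < r / 4 := hδ0.eventually_lt_const (by positivity)
      have e3 : ∀ᶠ k in (𝒰 : Filter ℕ), δ k < (T - s) / 2 :=
        hδ0.eventually_lt_const (by linarith [hs.2])
      have e4 : ∀ᶠ k in (𝒰 : Filter ℕ), δ k < 1 / (K + 1) :=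
        hδ0.eventually_lt_const (by positivity)
      filter_upwards [e1, e2, e3, e4] with k e1 e2 e3 e4
      refine hB k p c r (Y s) s b hs.1.le hb.1 (show b ≤ T - δ k by linarith) hL fun τ hτ => ?_
      have hτm : τ ∈ Icc 0 T := ⟨hs.1.le.trans hτ.1, hτ.2.trans hbm.2⟩
      have h1 : M * dist (y k s) (y k τ) ≤ F k τ - F k s + K * (τ - s) + K * δ k :=
        hC k M K hM.le hK0 hK s τ hs.1.le hτ.1 hτm.2
      have h2 : K * δ k ≤ 1 := by
        rw [lt_div_iff₀ (by positivity)] at e4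
        nlinarith [hδpos k]
      have h3 : K * (τ - s) ≤ K * (b - s) := by
        have := hτ.2
        gcongr
      have h4 : M * dist (y k s) (y k τ) ≤ w₀ + 3 := by
        linarith [(hFmem k τ hτm).2, (hFmem k s hsm).1]
      have h5 : dist (y k s) (y k τ) ≤ r / 2 := by
        refine le_of_mul_le_mul_left (h4.trans_eq ?_) hM
        rw [hM_def]; field_simp
      have h6 := dist_triangle_left (y k τ) (Y s) (y k s)
      rw [← dist_eq_norm]
      change dist (y k τ) (Y s) + δ k < r
      linarith)
  refine ⟨Y, u, hu, hY0 ▸ hYu, hLu, ?_⟩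
  rw [hΦ0, sub_zero] at hcost
  refine (add_le_add_left (EReal.coe_le_coe_iff.2 hcost) _).trans ?_
  have hz : Tendsto z 𝒰 (𝓝[{q : ℝ × Euc n | 0 ≤ q.1}] (0, Y T)) := by
    refine tendsto_nhdsWithin_iff.2 ⟨?_, Eventually.of_forall hz0⟩
    have h1 : Tendsto (fun k => (z k).1) 𝒰 (𝓝 0) := squeeze_zero hz0 hzδ hδ0
    have h2 : Tendsto (fun k => (z k).2 - y k T) 𝒰 (𝓝 0) := squeeze_zero_norm hzy hδ0
    have h3 : Tendsto (fun k => (z k).2) 𝒰 (𝓝 (Y T)) := by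
      simpa using h2.add (hY T hTmem)
    exact h1.prodMk_nhds h3
  have hWΦ : W (0, Y T) ≤ ((w₀ - Φ T : ℝ) : EReal) := by
    refine le_of_forall_lt fun v hv => ?_
    obtain ⟨v', hv', hv'W⟩ := exists_between hv
    refine hv'.trans_le ?_
    have h1 := hz.eventually (hWlsc (0, Y T) (show (0 : ℝ) ≤ 0 from le_rfl) v' hv'W)
    have h2 : Tendsto (fun k => ((w₀ + δ k - F k T : ℝ) : EReal)) 𝒰
        (𝓝 ((w₀ - Φ T : ℝ) : EReal)) := by
      have := (hδ0.const_add w₀).sub (hΦ T hTmem)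
      rw [add_zero] at this
      exact (continuous_coe_real_ereal.tendsto _).comp this
    refine ge_of_tendsto h2 ?_
    filter_upwards [h1] with k h1
    obtain ⟨w, hw, -, hwg⟩ := EReal.exists_real_of_add_coe_le (hW0 (z k)) (hzW k)
    refine h1.le.trans ?_
    rw [hw, EReal.coe_le_coe_iff]
    change w + F k T ≤ w₀ + δ k at hwg
    linarith
  refine (add_le_add_right hWΦ _).trans ?_
  norm_cast
  linarith

theorem stmt13 {n : ℕ} (L : Euc n → Euc n → ℝ) (Θ : Euc n → ℝ) (φ : Euc n → EReal)
    (W : ℝ × Euc n → EReal)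
    (hL0 : ∀ x u, 0 ≤ L x u)
    (hLlsc : LowerSemicontinuous (fun q : Euc n × Euc n => L q.1 q.2))
    (hLloc : ∀ q : Euc n × Euc n, ∃ U ∈ 𝓝 q, ∃ C : ℝ, ∀ r ∈ U, L r.1 r.2 ≤ C)
    (hconv : ∀ x, ConvexOn ℝ Set.univ (L x))
    (hΘ0 : ∀ u, 0 ≤ Θ u) (hΘsl : Superlinear Θ) (hcoer : ∀ x u, Θ u ≤ L x u)
    (hφ0 : ∀ x, 0 ≤ φ x) (hφlsc : LowerSemicontinuous φ)
    (hW0 : ∀ q, 0 ≤ W q)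
    (hWlsc : LowerSemicontinuousOn W {q : ℝ × Euc n | 0 ≤ q.1})
    (htech0 : ∀ t : ℝ, ∀ x : Euc n, 0 < t → W (t, x) ≠ ⊤ →
      Dup W (t, x) ((0:ℝ), (0:Euc n)) = 0)
    (htech1 : ∀ t : ℝ, ∀ x : Euc n, 0 < t → W (t, x) ≠ ⊤ →
      ∃ u : Euc n, Dup W (t, x) ((-1:ℝ), u) < ⊤)
    (hinit : ∀ x, W (0, x) = φ x)
    (hsuper : ∀ t : ℝ, ∀ x : Euc n, 0 < t → ∀ p ∈ subdiffP W (t, x),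
      (0 : EReal) ≤ (p.1 : ℝ) + Ham L x (-p.2)) :
    ∀ t : ℝ, ∀ x : Euc n, 0 ≤ t → bolzaValue L φ t x ≤ W (t, x) := by
  intro t x ht
  rcases eq_or_ne (W (t, x)) ⊤ with htop | htop
  · rw [htop]; exact le_top
  rcases ht.eq_or_lt with rfl | ht
  · refine sInf_le ⟨fun _ => 0, ?_, ?_, ?_⟩ <;> simp [hinit]
  have hbot : W (t, x) ≠ ⊥ := fun h => by have := hW0 (t, x); rw [h] at this; simp at this
  have hw₀ : W (t, x) = ((W (t, x)).toReal : EReal) := (EReal.coe_toReal htop hbot).symm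
  obtain ⟨Y, u, hu, hY, hLu, hle⟩ := exists_control_of_supersolution hL0 hLlsc hconv hΘ0 hΘsl hcoer
    hW0 hWlsc hsuper ht hw₀
  rw [hinit, ← hw₀] at hle
  refine le_trans (sInf_le ⟨u, hu, ?_, ?_⟩) hle
  · refine hLu.congr_uIoo fun s hs => ?_
    rw [uIoo_of_le ht.le] at hs
    simp only [hY s ⟨hs.1.le, hs.2.le⟩]
  · rw [hY t ⟨ht.le, le_rfl⟩]
    congr 2
    refine intervalIntegral.integral_congr fun s hs => ?_
    rw [uIcc_of_le ht.le] at hs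
    simp only [hY s hs]
end
end

section
/- (Reduction step in the supersolution comparison) Under the hypotheses of the comparison theorem for viscosity supersolutions, for every (t,x) ∈ dom(W) with t > 0 there exists u ∈ ℝⁿ such that D↑W(t,x)(−1,u) ≤ −L(x,u). In other words, a lower semicontinuous viscosity supersolution satisfying the technical conditions D↑W(t,x)(0,0)=0 and the finiteness condition is a contingent supersolution. -/
open Filter Topology Metric Set
open scoped RealInnerProductSpace

noncomputable section

theorem EReal.lt_of_lt_inv_mul_sub {h c w₀ : ℝ} (hh : 0 < h) {w : EReal} (hw : 0 ≤ w)
    (H : (c : EReal) < ((h⁻¹ : ℝ) : EReal) * (w - (w₀ : EReal))) :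
    ((w₀ + c * h : ℝ) : EReal) ≤ w := by
  induction w with
  | bot => simp at hw
  | top => exact le_top
  | coe w =>
    norm_cast at H ⊢
    rw [inv_mul_eq_div, lt_div_iff₀ hh] at H
    linarith

theorem EReal.le_of_inv_mul_sub_lt {h c w₀ : ℝ} (hh : 0 < h) {w : EReal} (hw : 0 ≤ w)
    (H : ((h⁻¹ : ℝ) : EReal) * (w - (w₀ : EReal)) < (c : EReal)) :
    w ≤ ((w₀ + c * h : ℝ) : EReal) := by
  induction w with
  | bot => simp at hw
  | top => simp [EReal.coe_mul_top_of_pos (inv_pos.2 hh)] at H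
  | coe w =>
    norm_cast at H ⊢
    rw [inv_mul_eq_div, div_lt_iff₀ hh] at H
    linarith

theorem Superlinear.exists_linear_lower_bound {n : ℕ} {Θ : Euc n → ℝ} (h : Superlinear Θ)
    (h0 : ∀ u, 0 ≤ Θ u) {A : ℝ} (hA : 0 ≤ A) : ∃ D, 0 ≤ D ∧ ∀ u, A * ‖u‖ - D ≤ Θ u := by
  have h1 := h.eventually_ge_atTop A
  rw [eventually_comap, eventually_atTop] at h1
  obtain ⟨ρ, hρ⟩ := h1
  refine ⟨A * max ρ 1, by positivity, fun u => ?_⟩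
  rcases le_total (max ρ 1) ‖u‖ with hu | hu
  · have hu1 : 1 ≤ ‖u‖ := (le_max_right _ _).trans hu
    have h2 := hρ ‖u‖ ((le_max_left _ _).trans hu) u rfl
    rw [le_div_iff₀ (by linarith)] at h2
    have : 0 ≤ A * max ρ 1 := by positivity
    linarith
  · have h2 := mul_le_mul_of_nonneg_left hu hA
    have := h0 u
    linarith

theorem ConvexOn.exists_uniform_lower_lipschitz {E : Type*} [NormedAddCommGroup E]
    [NormedSpace ℝ E] [FiniteDimensional ℝ E] {f : E → ℝ} (hf : ConvexOn ℝ univ f)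
    (h0 : ∀ u, 0 ≤ f u) (R : ℝ) :
    ∃ G, 0 ≤ G ∧ ∀ u v : E, ‖u‖ ≤ R → f u - G * ‖v - u‖ ≤ f v := by
  have hc : ContinuousOn f univ := hf.continuousOn isOpen_univ
  obtain ⟨G, hG⟩ := (isCompact_closedBall (0 : E) (R + 1)).bddAbove_image
    (hc.mono (subset_univ _))
  refine ⟨max G 0, le_max_right _ _, fun u v hu => ?_⟩
  rcases eq_or_ne v u with rfl | hvu
  · simp
  have hd : 0 < ‖v - u‖ := norm_pos_iff.2 (sub_ne_zero.2 hvu)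
  set d := ‖v - u‖ with hd_def
  set u' : E := u + d⁻¹ • (u - v) with hu'
  have hn : ‖d⁻¹ • (u - v)‖ = 1 := by
    rw [norm_smul, Real.norm_of_nonneg (inv_nonneg.2 hd.le), norm_sub_rev, ← hd_def,
      inv_mul_cancel₀ hd.ne']
  have hfu' : f u' ≤ max G 0 := by
    refine (hG ⟨u', ?_, rfl⟩).trans (le_max_left _ _)
    rw [mem_closedBall_zero_iff]
    exact (norm_add_le _ _).trans (by linarith)
  have hcomb : u = (1 / (1 + d)) • v + (d / (1 + d)) • u' := by
    have h1 : (1 + d) ≠ 0 := by positivity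
    have h2 : (1 + d) • u = v + d • u' := by
      rw [hu', smul_add, smul_smul, mul_inv_cancel₀ hd.ne']
      module
    have h3 : u = (1 + d)⁻¹ • ((1 + d) • u) := by rw [smul_smul, inv_mul_cancel₀ h1, one_smul]
    rw [h3, h2, smul_add, smul_smul, one_div, div_eq_inv_mul]
  have hconv := hf.2 (mem_univ v) (mem_univ u') (by positivity : 0 ≤ 1 / (1 + d))
    (by positivity : 0 ≤ d / (1 + d)) (by field_simp)
  rw [← hcomb, smul_eq_mul, smul_eq_mul] at hconv
  have h4 : (1 + d) * f u ≤ f v + d * f u' := by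
    have := mul_le_mul_of_nonneg_left hconv (by positivity : 0 ≤ 1 + d)
    field_simp at this
    linarith
  nlinarith [h0 u, mul_le_mul_of_nonneg_left hfu' hd.le]

theorem exists_calm_of_neg_one_lt_Dup_zero {F : Type*} [NormedAddCommGroup F] [NormedSpace ℝ F]
    {W : F → EReal} (hW0 : ∀ q, 0 ≤ W q) {x : F} {w₀ : ℝ} (hx : W x = w₀)
    (h : -1 < Dup W x 0) :
    ∃ C r : ℝ, 0 ≤ C ∧ 0 < r ∧ ∀ z, ‖z‖ < r → ((w₀ - C * ‖z‖ : ℝ) : EReal) ≤ W (x + z) := by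
  have h1 := eventually_lt_of_lt_liminf h
  rw [eventually_prod_iff] at h1
  obtain ⟨pa, hpa, pb, hpb, H⟩ := h1
  obtain ⟨d1, hd1, hpa⟩ := (mem_nhdsGT_iff_exists_Ioo_subset).1 hpa
  obtain ⟨d2, hd2, hpb⟩ := Metric.eventually_nhds_iff.1 hpb
  have hd1' : 0 < d1 := hd1
  refine ⟨2 / d2, d1 * d2 / 2, by positivity, by positivity, fun z hz => ?_⟩
  rcases eq_or_ne z 0 with rfl | hz0
  · simp [hx]
  have hzn : 0 < ‖z‖ := norm_pos_iff.2 hz0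
  set s := 2 * ‖z‖ / d2 with hs
  have hs0 : 0 < s := by positivity
  have hs1 : s < d1 := by
    rw [hs, div_lt_iff₀ hd2]; linarith
  have key := H (hpa ⟨hs0, hs1⟩) (y := s⁻¹ • z) (hpb (by
    rw [dist_zero_right, norm_smul, Real.norm_of_nonneg (inv_nonneg.2 hs0.le), hs]
    field_simp
    norm_num))
  simp only [smul_smul, mul_inv_cancel₀ hs0.ne', one_smul, hx] at key
  have := EReal.lt_of_lt_inv_mul_sub (c := -1) hs0 (hW0 _) (by simpa using key)
  convert this using 2
  rw [hs]; ring

theorem eventually_le_of_lt_Dup {F : Type*} [NormedAddCommGroup F] [NormedSpace ℝ F]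
    {W : F → EReal} (hW0 : ∀ q, 0 ≤ W q) {x : F} {w₀ : ℝ} (hx : W x = w₀) {u : F} {c : ℝ}
    (h : (c : EReal) < Dup W x u) :
    ∀ᶠ p : ℝ × F in 𝓝 (0, u), 0 < p.1 →
      ((w₀ + c * p.1 : ℝ) : EReal) ≤ W (x + p.1 • p.2) := by
  have h1 := eventually_lt_of_lt_liminf h
  rw [← nhdsWithin_univ u, ← nhdsWithin_prod_eq, eventually_nhdsWithin_iff] at h1
  filter_upwards [h1] with p hp h0
  exact EReal.lt_of_lt_inv_mul_sub h0 (hW0 _) (by rw [← hx]; exact hp ⟨h0, mem_univ _⟩)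

theorem exists_le_of_Dup_lt {F : Type*} [NormedAddCommGroup F] [NormedSpace ℝ F]
    {W : F → EReal} (hW0 : ∀ q, 0 ≤ W q) {x : F} {w₀ : ℝ} (hx : W x = w₀) {u : F} {c : ℝ}
    (h : Dup W x u < c) {s : Set F} (hs : s ∈ 𝓝 u) {η : ℝ} (hη : 0 < η) :
    ∃ h v, 0 < h ∧ h < η ∧ v ∈ s ∧ W (x + h • v) ≤ ((w₀ + c * h : ℝ) : EReal) := by
  have h1 := frequently_lt_of_liminf_lt (by isBoundedDefault) h
  have h2 : Ioo 0 η ×ˢ s ∈ (𝓝[>] (0:ℝ)) ×ˢ 𝓝 u := prod_mem_prod (Ioo_mem_nhdsGT hη) hs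
  obtain ⟨p, hp, hp1, hp2⟩ := (h1.and_eventually h2).exists
  exact ⟨p.1, p.2, hp1.1, hp1.2, hp2,
    EReal.le_of_inv_mul_sub_lt hp1.1 (hW0 _) (by rw [← hx]; exact hp)⟩

theorem LowerSemicontinuous.exists_uniform_lower_bound {X E : Type*} [NormedAddCommGroup X]
    [NormedAddCommGroup E] [ProperSpace E] {L : X → E → ℝ}
    (hL : LowerSemicontinuous (fun q : X × E => L q.1 q.2)) {x : X} (hc : Continuous (L x))
    (R : ℝ) {ε : ℝ} (hε : 0 < ε) :
    ∃ r, 0 < r ∧ ∀ y v, ‖y‖ < r → ‖v‖ ≤ R → L x v - ε ≤ L (x + y) v := by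
  have h1 := (isCompact_closedBall (0 : E) R).eventually_forall_of_forall_eventually
    (x₀ := x) (P := fun y v => L x v - ε ≤ L y v) (fun v _ => by
      have h2 := hL (x, v) (L x v - ε / 2) (by simp; linarith)
      have h3 : ∀ᶠ v' in 𝓝 v, L x v' < L x v + ε / 2 :=
        hc.continuousAt.eventually_lt continuousAt_const (by linarith)
      filter_upwards [h2, (continuous_snd.tendsto (x, v)).eventually h3] with z h4 h5
      linarith)
  obtain ⟨r, hr, H⟩ := Metric.eventually_nhds_iff.1 h1
  exact ⟨r, hr, fun y v hy hv => H (by simpa using hy) v (by simpa using hv)⟩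

/-- The perspective `h ↦ h ρ(y / h - v)` of the penalty `ρ(w) = K (√(δ² + ‖w‖²) - δ)`. -/
def penalty {E : Type*} [NormedAddCommGroup E] [NormedSpace ℝ E] (K δ h : ℝ) (y v : E) : ℝ :=
  K * (√(δ ^ 2 * h ^ 2 + ‖y - h • v‖ ^ 2) - δ * h)

section penalty

variable {E : Type*} [NormedAddCommGroup E] [InnerProductSpace ℝ E]

theorem le_penalty {K : ℝ} (hK : 0 ≤ K) (δ h : ℝ) (y v : E) :
    K * ‖y - h • v‖ - K * δ * h ≤ penalty K δ h y v := by
  have : ‖y - h • v‖ ≤ √(δ ^ 2 * h ^ 2 + ‖y - h • v‖ ^ 2) :=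
    Real.le_sqrt_of_sq_le (by nlinarith [mul_nonneg (sq_nonneg δ) (sq_nonneg h)])
  have := mul_le_mul_of_nonneg_left this hK
  unfold penalty
  linarith

theorem penalty_self (K : ℝ) {δ h : ℝ} (hδ : 0 ≤ δ) (hh : 0 ≤ h) (v : E) :
    penalty K δ h (h • v) v = 0 := by
  have : δ ^ 2 * h ^ 2 = (δ * h) ^ 2 := by ring
  simp [penalty, this, Real.sqrt_sq (mul_nonneg hδ hh)]

theorem continuous_penalty (K δ : ℝ) :
    Continuous fun p : ℝ × E × E => penalty K δ p.1 p.2.1 p.2.2 := by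
  unfold penalty
  fun_prop

/-- The arithmetic-geometric mean majorant of the penalty. -/
theorem penalty_le {K : ℝ} (hK : 0 ≤ K) (δ h : ℝ) (y v : E) {S : ℝ} (hS : 0 < S) :
    penalty K δ h y v ≤ K * ((S ^ 2 + δ ^ 2 * h ^ 2 + ‖y - h • v‖ ^ 2) / (2 * S) - δ * h) := by
  unfold penalty
  gcongr
  rw [le_div_iff₀ (by positivity)]
  set B := δ ^ 2 * h ^ 2 + ‖y - h • v‖ ^ 2 with hB
  have hB0 : 0 ≤ B := by positivity
  nlinarith [sq_nonneg (√B - S), Real.sq_sqrt hB0]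

theorem ConvexOn.subgradient_of_isMin_add_penalty {f : E → ℝ} (hf : ConvexOn ℝ univ f)
    {K δ h : ℝ} (hK : 0 ≤ K) (hδ : 0 < δ) (hh : 0 < h) {y v : E}
    (hmin : ∀ᶠ v' in 𝓝 v, h * f v + penalty K δ h y v ≤ h * f v' + penalty K δ h y v') (v' : E) :
    f v + ⟪(K / √(δ ^ 2 * h ^ 2 + ‖y - h • v‖ ^ 2)) • (y - h • v), v' - v⟫ ≤ f v' := by
  set w := y - h • v with hw
  set S := √(δ ^ 2 * h ^ 2 + ‖w‖ ^ 2) with hS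
  have hS0 : 0 < S := Real.sqrt_pos.2 (by positivity)
  have hSS : S ^ 2 = δ ^ 2 * h ^ 2 + ‖w‖ ^ 2 := Real.sq_sqrt (by positivity)
  set d := v' - v with hd
  set B := K * h ^ 2 * ‖d‖ ^ 2 / (2 * S) with hB
  have hcurve : Tendsto (fun τ : ℝ => v + τ • d) (𝓝[>] 0) (𝓝 v) := by
    have : Continuous fun τ : ℝ => v + τ • d := by fun_prop
    simpa using (this.tendsto 0).mono_left nhdsWithin_le_nhds
  have hlim : Tendsto (fun τ : ℝ => h * (f v + ⟪(K / S) • w, d⟫ - f v') - τ * B) (𝓝[>] 0)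
      (𝓝 (h * (f v + ⟪(K / S) • w, d⟫ - f v'))) := by
    have : Continuous fun τ : ℝ => h * (f v + ⟪(K / S) • w, d⟫ - f v') - τ * B := by fun_prop
    simpa using (this.tendsto 0).mono_left nhdsWithin_le_nhds
  have key : h * (f v + ⟪(K / S) • w, d⟫ - f v') ≤ 0 := by
    refine le_of_tendsto hlim ?_
    filter_upwards [hcurve.eventually hmin, Ioo_mem_nhdsGT (zero_lt_one (α := ℝ))] with τ h1 hτ
    have hτ0 := hτ.1
    have h2 := penalty_le hK δ h y (v + τ • d) hS0
    have h3 : y - h • (v + τ • d) = w - (τ * h) • d := by rw [hw]; module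
    have h4 : ‖w - (τ * h) • d‖ ^ 2 = ‖w‖ ^ 2 - 2 * (τ * h) * ⟪w, d⟫ + (τ * h) ^ 2 * ‖d‖ ^ 2 := by
      rw [norm_sub_sq_real, inner_smul_right, norm_smul, mul_pow, Real.norm_eq_abs, sq_abs]
      ring
    have h5 : penalty K δ h y v = K * (S - δ * h) := rfl
    have h6 : f (v + τ • d) ≤ f v + τ * (f v' - f v) := by
      have := hf.2 (mem_univ v) (mem_univ v') (by linarith [hτ.2] : 0 ≤ 1 - τ) hτ0.le (by ring)
      have h7 : (1 - τ) • v + τ • v' = v + τ • d := by rw [hd]; module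
      rw [h7, smul_eq_mul, smul_eq_mul] at this
      linarith
    rw [h3, h4] at h2
    rw [h5] at h1
    have h8 : (S ^ 2 + δ ^ 2 * h ^ 2 + (‖w‖ ^ 2 - 2 * (τ * h) * ⟪w, d⟫ + (τ * h) ^ 2 * ‖d‖ ^ 2))
        / (2 * S) = S - τ * h * (⟪w, d⟫ / S) + τ ^ 2 * (h ^ 2 * ‖d‖ ^ 2 / (2 * S)) := by
      field_simp
      linarith
    rw [h8] at h2
    have h9 : ⟪(K / S) • w, d⟫ = K * (⟪w, d⟫ / S) := by
      rw [real_inner_smul_left]; ring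
    have h10 : B = K * (h ^ 2 * ‖d‖ ^ 2 / (2 * S)) := by rw [hB]; ring
    rw [h9, h10]
    have h11 := mul_le_mul_of_nonneg_left h6 hh.le
    refine le_of_mul_le_mul_left ?_ hτ0
    nlinarith
  nlinarith

end penalty

theorem mem_subdiffP_of_eventually_le {n : ℕ} {W : ℝ × Euc n → EReal} {q p : ℝ × Euc n}
    {w : ℝ} (hw : W q = w) (hW0 : ∀ z, 0 ≤ W z) {ψ : ℝ × Euc n → ℝ} {ψ' : ℝ × Euc n →L[ℝ] ℝ}
    (hψ : HasFDerivAt ψ ψ' q) (hp : ∀ z, ψ' z = -(p.1 * z.1 + ⟪p.2, z.2⟫))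
    (hmin : ∀ᶠ z in 𝓝 q, W q + (ψ q : EReal) ≤ W z + (ψ z : EReal)) : p ∈ subdiffP W q := by
  intro ε hε
  filter_upwards [hmin, hψ.isLittleO.def hε] with z h1 h2
  rw [hp, Real.norm_eq_abs] at h2
  have h3 := (abs_le.1 h2).2
  simp only [Prod.fst_sub, Prod.snd_sub] at h3
  have h0 := hW0 z
  rw [hw] at h1 ⊢
  generalize W z = a at *
  induction a with
  | bot => simp at h0
  | top => exact le_top
  | coe a =>
    norm_cast at h1 ⊢
    linarith

theorem hasFDerivAt_testFunction {n : ℕ} (t₀ α β γ κ : ℝ) (x₀ v : Euc n) (q : ℝ × Euc n)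
    (hq : t₀ - q.1 ≠ 0) :
    ∃ ψ' : ℝ × Euc n →L[ℝ] ℝ,
      HasFDerivAt (fun z : ℝ × Euc n => α * (t₀ - z.1) + γ * (t₀ - z.1) ^ 2 +
        β * ‖z.2 - x₀ - (t₀ - z.1) • v‖ ^ 2 + κ * (t₀ - z.1)⁻¹) ψ' q ∧
      ∀ z, ψ' z = -((α + 2 * γ * (t₀ - q.1) - 2 * β * ⟪q.2 - x₀ - (t₀ - q.1) • v, v⟫
        - κ * ((t₀ - q.1) ^ 2)⁻¹) * z.1 +
        ⟪-((2 * β) • (q.2 - x₀ - (t₀ - q.1) • v)), z.2⟫) := by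
  have hT : HasFDerivAt (fun z : ℝ × Euc n => t₀ - z.1) (-ContinuousLinearMap.fst ℝ ℝ (Euc n)) q :=
    hasFDerivAt_fst.const_sub t₀
  have hY : HasFDerivAt (fun z : ℝ × Euc n => z.2 - x₀ - (t₀ - z.1) • v)
      (ContinuousLinearMap.snd ℝ ℝ (Euc n) -
        (-ContinuousLinearMap.fst ℝ ℝ (Euc n)).smulRight v) q :=
    (hasFDerivAt_snd.sub_const x₀).sub (hT.smul_const v)
  have hI := (hasDerivAt_inv hq).comp_hasFDerivAt q hT
  refine ⟨_, (((hT.const_mul α).add ((hT.pow 2).const_mul γ)).add (hY.norm_sq.const_mul β)).add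
    (hI.const_mul κ), fun z => ?_⟩
  simp [inner_sub_left, inner_smul_right, real_inner_smul_left, inner_neg_left]
  ring

theorem exists_small_le_of_Dup_lt_top {E : Type*} [NormedAddCommGroup E]
    [NormedSpace ℝ E] {W : ℝ × E → EReal} (hW0 : ∀ q, 0 ≤ W q) {t₀ : ℝ}
    {x₀ : E} {w₀ : ℝ} (hx : W (t₀, x₀) = w₀) {u₀ : E}
    (hfin : Dup W (t₀, x₀) ((-1 : ℝ), u₀) < ⊤) :
    ∃ M : ℝ, 0 ≤ M ∧ ∀ s ∈ 𝓝 u₀, ∀ η : ℝ, 0 < η → ∃ h u, 0 < h ∧ h < η ∧ u ∈ s ∧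
      W (t₀ - h, x₀ + h • u) ≤ ((w₀ + M * h : ℝ) : EReal) := by
  obtain ⟨M, hM, -⟩ := EReal.lt_iff_exists_real_btwn.1 hfin
  refine ⟨2 * |M|, by positivity, fun s hs η hη => ?_⟩
  have hg : ContinuousAt (fun z : ℝ × E => (-z.1)⁻¹ • z.2) ((-1 : ℝ), u₀) :=
    (continuousAt_fst.neg.inv₀ (by norm_num)).smul continuousAt_snd
  have hs' : ∀ᶠ z : ℝ × E in 𝓝 ((-1 : ℝ), u₀), (-z.1)⁻¹ • z.2 ∈ s :=
    hg.eventually (by simpa using hs)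
  have ht : ∀ᶠ z : ℝ × E in 𝓝 ((-1 : ℝ), u₀), z.1 ∈ Ioo (-2 : ℝ) (-1 / 2) :=
    (continuous_fst.tendsto _).eventually (Ioo_mem_nhds (by norm_num) (by norm_num))
  obtain ⟨h, z, h0, hh, ⟨hz1, hz2⟩, hle⟩ :=
    exists_le_of_Dup_lt hW0 hx hM (hs'.and ht) (half_pos hη)
  have hz3 : (1 : ℝ) / 2 < -z.1 := by linarith [hz2.2]
  have hz4 : -z.1 < 2 := by linarith [hz2.1]
  refine ⟨h * -z.1, (-z.1)⁻¹ • z.2, by nlinarith, by nlinarith, hz1, ?_⟩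
  rw [smul_smul, mul_assoc, mul_inv_cancel₀ (by linarith), mul_one]
  have h1 : ((t₀, x₀) : ℝ × E) + h • z = (t₀ - h * -z.1, x₀ + h • z.2) := by
    ext
    · simp
    · simp
  rw [h1] at hle
  refine hle.trans (EReal.coe_le_coe_iff.2 ?_)
  nlinarith [mul_le_mul_of_nonneg_right (le_abs_self M) h0.le,
    mul_nonneg (abs_nonneg M) (mul_nonneg h0.le (by linarith : 0 ≤ -z.1 - 1 / 2))]

section contingent

variable {E : Type*} [NormedAddCommGroup E] [InnerProductSpace ℝ E] [FiniteDimensional ℝ E]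

theorem exists_uniform_of_neg_lt_Dup {W : ℝ × E → EReal} (hW0 : ∀ q, 0 ≤ W q) {t₀ : ℝ} {x₀ : E}
    {w₀ : ℝ} (hx : W (t₀, x₀) = w₀) {f : E → ℝ} (hf : Continuous f)
    (h : ∀ u, ((-(f u) : ℝ) : EReal) < Dup W (t₀, x₀) ((-1 : ℝ), u)) (R : ℝ) :
    ∃ ε b : ℝ, 0 < ε ∧ ε ≤ 1 ∧ 0 < b ∧ ∀ h u, 0 < h → h < b → ‖u‖ ≤ R →
      ((w₀ - h * f u + 2 * ε * h : ℝ) : EReal) ≤ W (t₀ - h, x₀ + h • u) := by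
  have h1 := (isCompact_closedBall (0 : E) R).eventually_forall_of_forall_eventually
    (x₀ := ((0, 0) : ℝ × ℝ)) (P := fun p u => 0 < p.1 →
      ((w₀ - p.1 * f u + 2 * p.2 * p.1 : ℝ) : EReal) ≤ W (t₀ - p.1, x₀ + p.1 • u)) (fun u _ => by
      obtain ⟨c, hc1, hc2⟩ := EReal.lt_iff_exists_real_btwn.1 (h u)
      have hc1 : -(f u) < c := EReal.coe_lt_coe_iff.1 hc1
      have h2 := eventually_le_of_lt_Dup hW0 hx hc2
      have hm : Continuous fun z : (ℝ × ℝ) × E => (z.1.1, ((-1 : ℝ), z.2)) := by fun_prop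
      have h3 := (hm.tendsto ((0, 0), u)).eventually h2
      have hg : Continuous fun z : (ℝ × ℝ) × E => - f z.2 + 2 * z.1.2 := by fun_prop
      have h4 := (hg.tendsto ((0, 0), u)).eventually_lt_const (u := c) (by simpa using hc1)
      filter_upwards [h3, h4] with z h5 h6 hz
      have h7 := h5 hz
      simp only [Prod.smul_mk, Prod.mk_add_mk, smul_eq_mul, mul_neg, mul_one] at h7
      rw [← sub_eq_add_neg] at h7
      refine le_trans (EReal.coe_le_coe_iff.2 ?_) h7
      nlinarith)
  obtain ⟨ρ, hρ, H⟩ := Metric.eventually_nhds_iff.1 h1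
  refine ⟨min (ρ / 2) 1, ρ, by positivity, min_le_right _ _, hρ, fun h u h0 hb hu => ?_⟩
  refine H (y := (h, min (ρ / 2) 1)) ?_ u (by simpa using hu) h0
  have h2 : 0 < min (ρ / 2) 1 := by positivity
  have h3 : min (ρ / 2) 1 < ρ := (min_le_left _ _).trans_lt (by linarith)
  rw [Prod.dist_eq]
  simp only [dist_zero_right, Real.norm_eq_abs, abs_of_pos h0, abs_of_pos h2]
  exact max_lt hb h3

theorem exists_penalized_lower_bound {W : ℝ × E → EReal} (hW0 : ∀ q, 0 ≤ W q) {t₀ : ℝ} {x₀ : E}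
    {w₀ : ℝ} (hx : W (t₀, x₀) = w₀) {f : E → ℝ} (hf0 : ∀ u, 0 ≤ f u) (hf : ConvexOn ℝ univ f)
    (hsl : ∀ A, 0 ≤ A → ∃ D, 0 ≤ D ∧ ∀ u, A * ‖u‖ - D ≤ f u)
    (hcalm : -1 < Dup W (t₀, x₀) 0)
    (h : ∀ u, ((-(f u) : ℝ) : EReal) < Dup W (t₀, x₀) ((-1 : ℝ), u)) :
    ∃ K δ ε r R : ℝ, 0 < K ∧ 0 < δ ∧ 0 < ε ∧ ε ≤ 1 ∧ 0 < r ∧ 1 ≤ R ∧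
      ∀ h y v, 0 < h → h < r → ‖y‖ < r →
        ((w₀ + ε * h - h * f v - penalty K δ h y v : ℝ) : EReal) ≤ W (t₀ - h, x₀ + y) ∧
        (R * h ≤ ‖y‖ →
          ((w₀ + ‖y‖ - h * f v - penalty K δ h y v : ℝ) : EReal) ≤ W (t₀ - h, x₀ + y)) := by
  obtain ⟨C, r, hC, hr, hcalm⟩ := exists_calm_of_neg_one_lt_Dup_zero hW0 hx hcalm
  obtain ⟨D, hD, hfD⟩ := hsl (C + 2) (by linarith)
  have hfc : Continuous f := continuousOn_univ.1 (hf.continuousOn isOpen_univ)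
  obtain ⟨ε, b, hε, hε1, hb, hunif⟩ := exists_uniform_of_neg_lt_Dup hW0 hx hfc h (C + D + 2)
  obtain ⟨G, hG, hfG⟩ := hf.exists_uniform_lower_lipschitz hf0 (C + D + 2)
  set K := max G (C + 2) with hKdef
  have hKG : G ≤ K := le_max_left _ _
  have hKC : C + 2 ≤ K := le_max_right _ _
  have hK : 0 < K := by linarith
  refine ⟨K, ε / K, ε, min r b, C + D + 2, hK, by positivity, hε, hε1, by positivity, by linarith,
    fun h y v h0 hhr hyr => ?_⟩
  have hP := le_penalty hK.le (ε / K) h y v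
  rw [mul_div_cancel₀ _ hK.ne'] at hP
  have hlarge : (C + D + 2) * h ≤ ‖y‖ →
      ((w₀ + ‖y‖ - h * f v - penalty K (ε / K) h y v : ℝ) : EReal) ≤ W (t₀ - h, x₀ + y) := by
    intro hy
    have hz : ‖((-h, y) : ℝ × E)‖ < r := by
      rw [Prod.norm_mk, norm_neg, Real.norm_of_nonneg h0.le]
      exact max_lt (hhr.trans_le (min_le_left _ _)) (hyr.trans_le (min_le_left _ _))
    have hz' : ‖((-h, y) : ℝ × E)‖ ≤ h + ‖y‖ := by
      rw [Prod.norm_mk, norm_neg, Real.norm_of_nonneg h0.le]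
      exact max_le (by linarith [norm_nonneg y]) (by linarith)
    have h1 := hcalm _ hz
    rw [Prod.mk_add_mk, ← sub_eq_add_neg] at h1
    refine le_trans (EReal.coe_le_coe_iff.2 ?_) h1
    have h2 := mul_le_mul_of_nonneg_left hz' hC
    have h3 := mul_le_mul_of_nonneg_left (hfD v) h0.le
    have h4 : ‖y‖ ≤ ‖y - h • v‖ + h * ‖v‖ := by
      calc ‖y‖ = ‖(y - h • v) + h • v‖ := by simp
        _ ≤ _ := by
          refine (norm_add_le _ _).trans ?_
          rw [norm_smul, Real.norm_of_nonneg h0.le]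
    have h5 := mul_le_mul_of_nonneg_left h4 (by linarith : 0 ≤ C + 2)
    have h6 := mul_le_mul_of_nonneg_right hKC (norm_nonneg (y - h • v))
    nlinarith
  refine ⟨?_, hlarge⟩
  rcases le_total ((C + D + 2) * h) ‖y‖ with hy | hy
  · refine le_trans (EReal.coe_le_coe_iff.2 ?_) (hlarge hy)
    nlinarith [mul_nonneg hC h0.le, mul_nonneg hD h0.le]
  · have hu : ‖h⁻¹ • y‖ ≤ C + D + 2 := by
      rw [norm_smul, Real.norm_of_nonneg (inv_nonneg.2 h0.le), inv_mul_le_iff₀ h0]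
      linarith
    have h1 := hunif h (h⁻¹ • y) h0 (hhr.trans_le (min_le_right _ _)) hu
    rw [smul_smul, mul_inv_cancel₀ h0.ne', one_smul] at h1
    refine le_trans (EReal.coe_le_coe_iff.2 ?_) h1
    have h2 := mul_le_mul_of_nonneg_left (hfG _ v hu) h0.le
    have h3 : h * ‖v - h⁻¹ • y‖ = ‖y - h • v‖ := by
      rw [← Real.norm_of_nonneg h0.le, ← norm_smul, Real.norm_of_nonneg h0.le, smul_sub, smul_smul,
        mul_inv_cancel₀ h0.ne', one_smul, norm_sub_rev]
    have h4 := mul_le_mul_of_nonneg_right hKG (norm_nonneg (y - h • v))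
    nlinarith

set_option maxHeartbeats 400000 in
theorem exists_penalized_local_min {W : ℝ × E → EReal} (hW0 : ∀ q, 0 ≤ W q)
    (hWlsc : LowerSemicontinuousOn W {q : ℝ × E | 0 ≤ q.1}) {t₀ : ℝ} (ht₀ : 0 < t₀) {x₀ : E}
    {w₀ : ℝ} (hx : W (t₀, x₀) = w₀) {f : E → ℝ} (hf0 : ∀ u, 0 ≤ f u) (hf : Continuous f)
    {u₀ : E} (hfin : Dup W (t₀, x₀) ((-1 : ℝ), u₀) < ⊤) {K δ ε r R : ℝ} (hK : 0 < K) (hδ : 0 < δ)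
    (hε : 0 < ε) (hε1 : ε ≤ 1) (hr : 0 < r) (hR : 1 ≤ R)
    (hlow : ∀ h y v, 0 < h → h < r → ‖y‖ < r →
        ((w₀ + ε * h - h * f v - penalty K δ h y v : ℝ) : EReal) ≤ W (t₀ - h, x₀ + y) ∧
        (R * h ≤ ‖y‖ →
          ((w₀ + ‖y‖ - h * f v - penalty K δ h y v : ℝ) : EReal) ≤ W (t₀ - h, x₀ + y))) :
    ∃ κ h y v ω, 0 < κ ∧ 0 < h ∧ h < t₀ ∧ ‖y‖ < r ∧ W (t₀ - h, x₀ + y) = ((ω : ℝ) : EReal) ∧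
      ∀ᶠ p : ℝ × E × E in 𝓝 (h, y, v),
        W (t₀ - h, x₀ + y) +
          ((h * f v + penalty K δ h y v - ε / 2 * h + κ * h⁻¹ : ℝ) : EReal) ≤
        W (t₀ - p.1, x₀ + p.2.1) +
          ((p.1 * f p.2.2 + penalty K δ p.1 p.2.1 p.2.2 - ε / 2 * p.1 + κ * p.1⁻¹ : ℝ) :
            EReal) := by
  have hR0 : 0 < R := by linarith
  set ρ := r / 2 with hρ
  have hρ0 : 0 < ρ := by positivity
  set b := min (ρ / (2 * R)) (t₀ / 2) with hb
  have hb0 : 0 < b := by positivity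
  have hRb : R * b ≤ ρ / 2 := by
    have : b ≤ ρ / (2 * R) := min_le_left _ _
    calc R * b ≤ R * (ρ / (2 * R)) := by gcongr
      _ = ρ / 2 := by field_simp
  have hbt : b < t₀ := (min_le_right _ _).trans_lt (by linarith)
  have hbρ : b ≤ ρ / 2 := by nlinarith
  set m := min (ε * b / 2) 1 with hm
  have hm0 : 0 < m := by positivity
  have hm1 : m ≤ 1 := min_le_right _ _
  have hm2 : m ≤ ε * b / 2 := min_le_left _ _
  obtain ⟨M, hM, hsmall⟩ := exists_small_le_of_Dup_lt_top hW0 hx hfin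
  set N := M + f u₀ + 2 with hN
  have hN0 : 0 < N := by have := hf0 u₀; linarith
  have hs : ∀ᶠ u in 𝓝 u₀, f u < f u₀ + 1 ∧ ‖u‖ < ‖u₀‖ + 1 :=
    (hf.continuousAt.eventually_lt continuousAt_const (by linarith)).and
      (continuous_norm.continuousAt.eventually_lt continuousAt_const (by linarith))
  obtain ⟨h₀, u, hh₀, hη, ⟨hfu, hun⟩, hWle⟩ :=
    hsmall _ hs (min (min (m / N) b) (min 1 (ρ / (‖u₀‖ + 1)))) (by positivity)
  simp only [lt_min_iff] at hη
  obtain ⟨⟨hη1, hη2⟩, hη3, hη4⟩ := hη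
  rw [lt_div_iff₀ hN0] at hη1
  rw [lt_div_iff₀ (by positivity)] at hη4
  set κ := h₀ ^ 2 with hκ
  have hκ0 : 0 < κ := by positivity
  have hκh : κ ≤ h₀ := by nlinarith
  set V := max (‖u‖ + 1) ((w₀ + m + K * ρ + K * δ * b + ε * b) / (K * κ)) with hV
  have hV1 : ‖u‖ < V := (lt_add_one _).trans_le (le_max_left _ _)
  have hV2 : w₀ + m + K * ρ + K * δ * b + ε * b ≤ K * κ * V := by
    rw [← div_le_iff₀' (by positivity)]
    exact le_max_right _ _
  set g : ℝ × E × E → ℝ := fun p =>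
    p.1 * f p.2.2 + penalty K δ p.1 p.2.1 p.2.2 - ε / 2 * p.1 + κ * p.1⁻¹ with hg
  set Φ : ℝ × E × E → EReal := fun p => W (t₀ - p.1, x₀ + p.2.1) + (g p : EReal) with hΦ
  set A : Set (ℝ × E × E) := Icc κ b ×ˢ closedBall 0 ρ ×ˢ closedBall 0 V with hA
  have hAc : IsCompact A :=
    isCompact_Icc.prod ((isCompact_closedBall _ _).prod (isCompact_closedBall _ _))
  have hstart : (h₀, h₀ • u, u) ∈ A := by
    refine ⟨⟨hκh, hη2.le⟩, ?_, ?_⟩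
    · rw [mem_closedBall_zero_iff]
      simp only
      rw [norm_smul, Real.norm_of_nonneg hh₀.le]
      nlinarith
    · simpa using hV1.le
  have hΦstart : Φ (h₀, h₀ • u, u) < ((w₀ + m : ℝ) : EReal) := by
    have h1 : Φ (h₀, h₀ • u, u) ≤ ((w₀ + M * h₀ : ℝ) : EReal) + (g (h₀, h₀ • u, u) : EReal) :=
      add_le_add hWle le_rfl
    refine h1.trans_lt ?_
    rw [← EReal.coe_add, EReal.coe_lt_coe_iff, hg]
    simp only
    rw [penalty_self K hδ.le hh₀.le, hκ, pow_two, mul_assoc, mul_inv_cancel₀ hh₀.ne']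
    have := mul_le_mul_of_nonneg_left hfu.le hh₀.le
    have : 0 < ε / 2 * h₀ := by positivity
    nlinarith
  have hgc : ContinuousOn g A := by
    have h1 : Continuous fun p : ℝ × E × E =>
        p.1 * f p.2.2 + penalty K δ p.1 p.2.1 p.2.2 - ε / 2 * p.1 := by
      have := continuous_penalty (E := E) K δ
      fun_prop
    refine h1.continuousOn.add (continuousOn_const.mul (continuousOn_fst.inv₀ fun p hp => ?_))
    exact (hκ0.trans_le hp.1.1).ne'
  have hΦlsc : LowerSemicontinuousOn Φ A := by
    refine LowerSemicontinuousOn.add' (f := fun p : ℝ × E × E => W (t₀ - p.1, x₀ + p.2.1))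
      (g := fun p => (g p : EReal)) ?_ ?_ ?_
    · refine hWlsc.comp (g := fun p : ℝ × E × E => (t₀ - p.1, x₀ + p.2.1)) ?_ ?_
      · exact Continuous.continuousOn (by fun_prop)
      · intro p hp
        have := hp.1.2
        rw [mem_ofPred_eq]
        linarith
    · exact (continuous_coe_real_ereal.comp_continuousOn hgc).lowerSemicontinuousOn
    · intro p _
      exact EReal.continuousAt_add (Or.inr (EReal.coe_ne_bot _)) (Or.inr (EReal.coe_ne_top _))
  obtain ⟨⟨h, y, v⟩, hmem, hmin⟩ := hΦlsc.exists_isMinOn ⟨_, hstart⟩ hAc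
  have hlt : Φ (h, y, v) < ((w₀ + m : ℝ) : EReal) := (hmin hstart).trans_lt hΦstart
  obtain ⟨⟨hκh', hhb⟩, hyρ, hvV⟩ := hmem
  rw [mem_closedBall_zero_iff] at hyρ hvV
  simp only at hκh' hhb hyρ hvV
  have hh : 0 < h := hκ0.trans_le hκh'
  have hW' := hlow h y v hh (by linarith) (by linarith)
  have hWnn := hW0 (t₀ - h, x₀ + y)
  obtain ⟨ω, hω⟩ : ∃ ω : ℝ, W (t₀ - h, x₀ + y) = ω := by
    simp only [hΦ] at hlt
    generalize W (t₀ - h, x₀ + y) = a at *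
    induction a with
    | bot => simp at hWnn
    | top => simp at hlt
    | coe a => exact ⟨a, rfl⟩
  simp only [hΦ, hω, hg] at hlt
  rw [hω] at hW' hWnn
  norm_cast at hlt hW' hWnn
  obtain ⟨hWa, hWb⟩ := hW'
  have hinv : 0 < κ * h⁻¹ := by positivity
  have hεh : 0 < ε * h := by positivity
  have hεb : ε * h ≤ ε * b := by gcongr
  have hεb' : ε * b ≤ b := by nlinarith
  have hh1 : κ < h := by
    refine lt_of_le_of_ne hκh' fun heq => ?_
    rw [heq, mul_inv_cancel₀ hh.ne'] at hlt
    linarith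
  have hh2 : h < b := by
    refine lt_of_le_of_ne hhb fun heq => ?_
    rw [heq] at hlt hWa hinv
    linarith
  have hy1 : ‖y‖ < ρ := by
    refine lt_of_le_of_ne hyρ fun heq => ?_
    have h1 : R * h ≤ R * b := mul_le_mul_of_nonneg_left hhb hR0.le
    have h2 := hWb (by linarith)
    linarith
  have hv1 : ‖v‖ < V := by
    refine lt_of_le_of_ne hvV fun heq => ?_
    have h1 := le_penalty hK.le δ h y v
    have h2 : h * V ≤ ‖y - h • v‖ + ‖y‖ := by
      have := norm_sub_norm_le (h • v) y
      rw [norm_smul, Real.norm_of_nonneg hh.le, heq, norm_sub_rev] at this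
      linarith
    have h3 := mul_le_mul_of_nonneg_left h2 hK.le
    have hVpos : 0 ≤ V := heq ▸ norm_nonneg v
    have h4 : K * κ * V ≤ K * (h * V) := by
      rw [mul_assoc]; gcongr
    have h5 : K * ‖y‖ ≤ K * ρ := by gcongr
    have h6 : K * δ * h ≤ K * δ * b := by gcongr
    have h7 : 0 ≤ h * f v := mul_nonneg hh.le (hf0 v)
    linarith
  refine ⟨κ, h, y, v, ω, hκ0, hh, by linarith, by linarith, hω, ?_⟩
  have hnhds : A ∈ 𝓝 (h, y, v) := by
    refine prod_mem_nhds (Icc_mem_nhds hh1 hh2) (prod_mem_nhds ?_ ?_)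
    · exact mem_of_superset (isOpen_ball.mem_nhds (by simpa using hy1)) ball_subset_closedBall
    · exact mem_of_superset (isOpen_ball.mem_nhds (by simpa using hv1)) ball_subset_closedBall
  filter_upwards [hnhds] with p hp using hmin hp

end contingent

theorem stmt14 {n : ℕ} (L : Euc n → Euc n → ℝ) (Θ : Euc n → ℝ)
    (W : ℝ × Euc n → EReal)
    (hL0 : ∀ x u, 0 ≤ L x u)
    (hLlsc : LowerSemicontinuous (fun q : Euc n × Euc n => L q.1 q.2))
    (hLloc : ∀ q : Euc n × Euc n, ∃ U ∈ 𝓝 q, ∃ C : ℝ, ∀ r ∈ U, L r.1 r.2 ≤ C)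
    (hconv : ∀ x, ConvexOn ℝ Set.univ (L x))
    (hΘ0 : ∀ u, 0 ≤ Θ u) (hΘsl : Superlinear Θ) (hcoer : ∀ x u, Θ u ≤ L x u)
    (hW0 : ∀ q, 0 ≤ W q)
    (hWlsc : LowerSemicontinuousOn W {q : ℝ × Euc n | 0 ≤ q.1})
    (htech0 : ∀ t : ℝ, ∀ x : Euc n, 0 < t → W (t, x) ≠ ⊤ →
      Dup W (t, x) ((0:ℝ), (0:Euc n)) = 0)
    (htech1 : ∀ t : ℝ, ∀ x : Euc n, 0 < t → W (t, x) ≠ ⊤ →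
      ∃ u : Euc n, Dup W (t, x) ((-1:ℝ), u) < ⊤)
    (hsuper : ∀ t : ℝ, ∀ x : Euc n, 0 < t → ∀ p ∈ subdiffP W (t, x),
      (0 : EReal) ≤ (p.1 : ℝ) + Ham L x (-p.2)) :
    ∀ t : ℝ, ∀ x : Euc n, 0 < t → W (t, x) ≠ ⊤ →
      ∃ u : Euc n, Dup W (t, x) ((-1:ℝ), u) ≤ ((-(L x u) : ℝ) : EReal) := by
  intro t₀ x₀ ht₀ hWx
  by_contra! hcon
  obtain ⟨w₀, hw₀⟩ : ∃ w₀ : ℝ, W (t₀, x₀) = w₀ :=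
    ⟨_, (EReal.coe_toReal hWx (ne_bot_of_le_ne_bot EReal.zero_ne_bot (hW0 _))).symm⟩
  have hsl : ∀ A, 0 ≤ A → ∃ D, 0 ≤ D ∧ ∀ x u, A * ‖u‖ - D ≤ L x u := fun A hA => by
    obtain ⟨D, hD, h⟩ := hΘsl.exists_linear_lower_bound hΘ0 hA
    exact ⟨D, hD, fun x u => (h u).trans (hcoer x u)⟩
  have hLc : Continuous (L x₀) :=
    continuousOn_univ.1 ((hconv x₀).continuousOn isOpen_univ)
  have hcalm : -1 < Dup W (t₀, x₀) 0 := by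
    have h1 := htech0 t₀ x₀ ht₀ hWx
    rw [← Prod.zero_eq_mk] at h1
    rw [h1]
    exact EReal.coe_lt_coe_iff.2 (by norm_num : (-1 : ℝ) < 0)
  obtain ⟨K, δ, ε, r, R, hK, hδ, hε, hε1, hr, hR, hlow⟩ :=
    exists_penalized_lower_bound hW0 hw₀ (hL0 x₀) (hconv x₀)
      (fun A hA => (hsl A hA).imp fun D hD => ⟨hD.1, hD.2 x₀⟩) hcalm hcon
  obtain ⟨D, hD, hLD⟩ := hsl (K + 1) (by linarith)
  obtain ⟨r', hr', hLr⟩ := hLlsc.exists_uniform_lower_bound (x := x₀) hLc (D + L x₀ 0)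
    (by positivity : 0 < ε / 4)
  obtain ⟨u₀, hu₀⟩ := htech1 t₀ x₀ ht₀ hWx
  obtain ⟨κ, h, y, v, ω, hκ, hh, hht, hy, hω, hmin⟩ :=
    exists_penalized_local_min hW0 hWlsc ht₀ hw₀ (hL0 x₀) hLc hu₀ hK hδ hε hε1
      (lt_min hr hr') hR
      (fun h y v h0 h1 h2 =>
        hlow h y v h0 (h1.trans_le (min_le_left _ _)) (h2.trans_le (min_le_left _ _)))
  have hyr' : ‖y‖ < r' := hy.trans_le (min_le_right _ _)
  set S := √(δ ^ 2 * h ^ 2 + ‖y - h • v‖ ^ 2) with hS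
  have hS0 : 0 < S := Real.sqrt_pos.2 (by positivity)
  have hSS : S ^ 2 = δ ^ 2 * h ^ 2 + ‖y - h • v‖ ^ 2 := Real.sq_sqrt (by positivity)
  set ξ := (K / S) • (y - h • v) with hξ
  have hpen : penalty K δ h y v = K * (S - δ * h) := rfl
  have hsub : ∀ v', L x₀ v + ⟪ξ, v' - v⟫ ≤ L x₀ v' := by
    refine (hconv x₀).subgradient_of_isMin_add_penalty hK.le hδ hh ?_
    have hc : Continuous fun v' : Euc n => (h, y, v') := by fun_prop
    filter_upwards [(hc.tendsto v).eventually hmin] with v' h1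
    rw [hω] at h1
    norm_cast at h1
    linarith
  have hξK : ‖ξ‖ ≤ K := by
    have : ‖y - h • v‖ ≤ S := Real.le_sqrt_of_sq_le (by nlinarith [sq_nonneg (δ * h)])
    rw [hξ, norm_smul, Real.norm_of_nonneg (by positivity), div_mul_eq_mul_div, div_le_iff₀ hS0]
    gcongr
  have hHam : Ham L (x₀ + y) ξ ≤ ((⟪ξ, v⟫ - L x₀ v + ε / 4 : ℝ) : EReal) := by
    refine iSup_le fun v' => EReal.coe_le_coe_iff.2 ?_
    rcases le_total ‖v'‖ (D + L x₀ 0) with hv' | hv'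
    · have h1 := hLr y v' hyr' hv'
      have h2 := hsub v'
      rw [inner_sub_right] at h2
      linarith
    · have h1 := hLD (x₀ + y) v'
      have h2 := hsub 0
      rw [inner_sub_right, inner_zero_right] at h2
      have h3 : ⟪ξ, v'⟫ ≤ K * ‖v'‖ := (real_inner_le_norm _ _).trans (by gcongr)
      linarith
  have hq : t₀ - (t₀ - h) = h := by ring
  obtain ⟨ψ', hψ', hψ'v⟩ := hasFDerivAt_testFunction t₀ (L x₀ v - K * δ - ε / 2) (K / (2 * S))
    (K * δ ^ 2 / (2 * S)) κ x₀ v (t₀ - h, x₀ + y) (by simp [hh.ne'])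
  simp only [hq, add_sub_cancel_left] at hψ'v
  have hxi : (2 * (K / (2 * S))) • (y - h • v) = ξ := by
    rw [hξ]; congr 1; field_simp
  have hmem := mem_subdiffP_of_eventually_le
    (p := (L x₀ v - K * δ - ε / 2 + 2 * (K * δ ^ 2 / (2 * S)) * h
      - 2 * (K / (2 * S)) * ⟪y - h • v, v⟫ - κ * (h ^ 2)⁻¹,
      -((2 * (K / (2 * S))) • (y - h • v)))) hω hW0
    (hψ'.add_const (K * S / 2)) hψ'v (by
      have hc : Continuous fun z : ℝ × Euc n => (t₀ - z.1, z.2 - x₀, v) := by fun_prop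
      have h1 := (hc.tendsto (t₀ - h, x₀ + y))
      simp only [hq, add_sub_cancel_left] at h1
      filter_upwards [h1.eventually hmin] with z h2
      simp only [sub_sub_cancel, add_sub_cancel] at h2
      have h3 := penalty_le hK.le δ (t₀ - z.1) (z.2 - x₀) v hS0
      simp only [hq, add_sub_cancel_left]
      refine (le_of_eq ?_).trans (h2.trans (add_le_add le_rfl (EReal.coe_le_coe_iff.2 ?_)))
      · congr 2
        rw [hpen]
        have h4 : S = (δ ^ 2 * h ^ 2 + ‖y - h • v‖ ^ 2) / (2 * S) + S / 2 := by
          field_simp; linarith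
        linear_combination (-K) * h4
      · refine (add_le_add_left (sub_le_sub_right (add_le_add_right h3 _) _) _).trans
          (le_of_eq ?_)
        field_simp
        ring)
  have hfin := hsuper _ _ (by linarith : 0 < t₀ - h) _ hmem
  simp only [neg_neg, hxi] at hfin
  have hfin' := hfin.trans (add_le_add le_rfl hHam)
  norm_cast at hfin'
  have h1 : ⟪ξ, v⟫ = 2 * (K / (2 * S)) * ⟪y - h • v, v⟫ := by
    rw [← hxi, real_inner_smul_left]
  have h2 : 2 * (K * δ ^ 2 / (2 * S)) * h ≤ K * δ := by
    have : δ * h ≤ S := Real.le_sqrt_of_sq_le (by nlinarith [sq_nonneg ‖y - h • v‖])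
    have h3 : 2 * (K * δ ^ 2 / (2 * S)) * h = K * δ * (δ * h) / S := by field_simp
    rw [h3, div_le_iff₀ hS0]
    gcongr
  have h4 : 0 < κ * (h ^ 2)⁻¹ := by positivity
  linarith
end
end

section
/- (Contingent comparison theorem) Let L : ℝⁿ × ℝⁿ → [0,∞) be lower semicontinuous, locally bounded, convex in u, with L(x,u) ≥ Θ(u) for Θ superlinear, and let φ : ℝⁿ → [0,∞] be lower semicontinuous. Let W : [0,∞) × ℝⁿ → [0,∞] be lower semicontinuous with W(0,·) = φ, and suppose that for every (t,x) ∈ dom(W) with t > 0 there exists u ∈ ℝⁿ with D↑W(t,x)(−1,u) ≤ −L(x,u). Then W ≥ V on [0,∞) × ℝⁿ, where V is the value function of the Bolza problem with Lagrangian L and final cost φ. -/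
open Filter Topology Metric Set
open scoped RealInnerProductSpace

noncomputable section

section Descent

variable {E : Type*} [NormedAddCommGroup E] [NormedSpace ℝ E]

/-- The affine function `u ↦ c + p u` minorizes `L x` for every `x ∈ X`. -/
def IsAffineMinorant (L : E → E → ℝ) (X : Set E) (p : E →L[ℝ] ℝ) (c : ℝ) : Prop :=
  ∀ x ∈ X, ∀ u, c + p u ≤ L x u

/-- A Lagrangian growing faster than every multiple of the norm, uniformly in the state. -/
def UniformlyCoercive (L : E → E → ℝ) : Prop :=
  ∀ M : ℝ, ∃ C : ℝ, 0 ≤ C ∧ ∀ x u, M * ‖u‖ - C ≤ L x u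

lemma Superlinear.exists_le {n : ℕ} {Θ : Euc n → ℝ} (h : Superlinear Θ) (h0 : ∀ u, 0 ≤ Θ u)
    (M : ℝ) : ∃ C : ℝ, 0 ≤ C ∧ ∀ u, M * ‖u‖ - C ≤ Θ u := by
  have h1 := h.eventually_ge_atTop M
  rw [eventually_comap, eventually_atTop] at h1
  obtain ⟨R, hR⟩ := h1
  refine ⟨|M| * |R|, by positivity, fun u => ?_⟩
  rcases le_or_gt R ‖u‖ with hu | hu
  · rcases (norm_nonneg u).eq_or_lt' with h2 | h2
    · rw [h2]
      have := h0 u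
      have : 0 ≤ |M| * |R| := by positivity
      linarith
    · have h3 := hR _ hu u rfl
      rw [le_div_iff₀ h2] at h3
      have : 0 ≤ |M| * |R| := by positivity
      linarith
  · have h2 : M * ‖u‖ ≤ |M| * |R| :=
      mul_le_mul (le_abs_self M) (hu.le.trans (le_abs_self R)) (norm_nonneg u) (abs_nonneg M)
    linarith [h0 u]

lemma UniformlyCoercive.exists_isAffineMinorant {L : E → E → ℝ} (hL : UniformlyCoercive L)
    (M : ℝ) : ∃ C : ℝ, 0 ≤ C ∧
      ∀ p : E →L[ℝ] ℝ, ‖p‖ ≤ M → IsAffineMinorant L univ p (-C) := by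
  obtain ⟨C, hC, h⟩ := hL M
  refine ⟨C, hC, fun p hp x _ u => ?_⟩
  have h1 : p u ≤ M * ‖u‖ :=
    (le_abs_self _).trans ((p.le_opNorm u).trans (by gcongr))
  linarith [h x u]

lemma mul_norm_le_of_forall_dual_le {M A : ℝ} (hM : 0 ≤ M) {v : E}
    (h : ∀ p : E →L[ℝ] ℝ, ‖p‖ ≤ M → p v ≤ A) : M * ‖v‖ ≤ A := by
  obtain ⟨g, hg, hgv⟩ := exists_dual_vector'' ℝ v
  have := h (M • g) (by
    rw [norm_smul, Real.norm_of_nonneg hM]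
    exact mul_le_of_le_one_right hM hg)
  simpa [hgv] using this

lemma exists_isAffineMinorant_ball [FiniteDimensional ℝ E] {L : E → E → ℝ}
    (hlsc : LowerSemicontinuous fun q : E × E => L q.1 q.2)
    (hconv : ∀ x, ConvexOn ℝ univ (L x)) (hcoer : UniformlyCoercive L)
    {x₀ u₀ : E} {a : ℝ} (ha : a < L x₀ u₀) :
    ∃ (p : E →L[ℝ] ℝ) (c r : ℝ), 0 < r ∧ IsAffineMinorant L (ball x₀ r) p c ∧ a ≤ c + p u₀ := by
  have hls : LowerSemicontinuous (L x₀) := hlsc.comp (g := fun u => (x₀, u)) (by fun_prop)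
  obtain ⟨a', ha1, ha2⟩ := exists_between ha
  obtain ⟨p, c, hle, heq⟩ := (hconv x₀).exists_affine_le_of_lt (𝕜 := ℝ) (mem_univ u₀) ha2
    isClosed_univ (lowerSemicontinuousOn_univ_iff.2 hls)
  have hle' : ∀ u, p u + c ≤ L x₀ u := fun u => by simpa using hle ⟨u, mem_univ u⟩
  replace heq : p u₀ + c = a' := by simpa using heq
  obtain ⟨C, hC, hCL⟩ := hcoer (‖p‖ + 1)
  have hK : IsCompact (closedBall (0 : E) (C + |c|)) := by
    have := FiniteDimensional.proper_real E
    exact isCompact_closedBall _ _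
  have key : ∀ᶠ x in 𝓝 x₀, ∀ u ∈ closedBall (0 : E) (C + |c|), c - (a' - a) + p u < L x u := by
    refine hK.eventually_forall_of_forall_eventually fun u _ => ?_
    have hg : LowerSemicontinuous fun q : E × E => L q.1 q.2 + -(p q.2) :=
      hlsc.add (Continuous.lowerSemicontinuous (by fun_prop))
    have := hg (x₀, u) (c - (a' - a)) (by
      have := hle' u
      simp only
      linarith)
    filter_upwards [this] with z hz
    linarith
  obtain ⟨r, hr, hball⟩ := Metric.eventually_nhds_iff_ball.1 key
  refine ⟨p, c - (a' - a), r, hr, fun x hx u => ?_, by linarith⟩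
  by_cases hu : u ∈ closedBall (0 : E) (C + |c|)
  · exact (hball x hx u hu).le
  · rw [mem_closedBall, dist_zero_right, not_le] at hu
    have h1 := hCL x u
    have h2 : p u ≤ ‖p‖ * ‖u‖ := (le_abs_self _).trans (p.le_opNorm u)
    have := le_abs_self c
    nlinarith

/-- A `δ`-approximate descending path for `W` on the time interval `[0, T]`, started at `(x₀, w₀)`,
given as the set of its points `(s, x, w)`: elapsed time, state, and upper bound for the value. -/
structure IsDescentSet (L : E → E → ℝ) (W : ℝ × E → EReal) (T : ℝ) (x₀ : E) (w₀ δ : ℝ)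
    (Γ : Set (ℝ × E × ℝ)) : Prop where
  start_mem : (0, x₀, w₀) ∈ Γ
  eq_start : ∀ q ∈ Γ, q.1 ≤ 0 → q = (0, x₀, w₀)
  nonneg : ∀ q ∈ Γ, 0 ≤ q.1
  le_end : ∀ q ∈ Γ, q.1 ≤ T
  value_le : ∀ q ∈ Γ, W (T - q.1, q.2.1) ≤ (q.2.2 : EReal)
  mesh : ∀ q ∈ Γ, ∀ s, 0 ≤ s → s ≤ q.1 → ∃ r ∈ Γ, s - δ ≤ r.1 ∧ r.1 ≤ s
  descent : ∀ q ∈ Γ, ∀ q' ∈ Γ, q.1 ≤ q'.1 → ∀ X p c, IsAffineMinorant L X p c →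
    (∀ r ∈ Γ, q.1 ≤ r.1 → r.1 ≤ q'.1 → r.2.1 ∈ X) →
    c * (q'.1 - q.1) + p (q'.2.1 - q.2.1) ≤
      q.2.2 - q'.2.2 + δ * (1 + ‖p‖ + |c|) * (q'.1 - q.1)

namespace IsDescentSet

variable {L : E → E → ℝ} {W : ℝ × E → EReal} {T : ℝ} {x₀ : E} {w₀ δ : ℝ} {Γ : Set (ℝ × E × ℝ)}

lemma singleton (hT : 0 ≤ T) (hδ : 0 ≤ δ) (hW : W (T, x₀) ≤ (w₀ : EReal)) :
    IsDescentSet L W T x₀ w₀ δ {(0, x₀, w₀)} where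
  start_mem := rfl
  eq_start := fun q hq _ => hq
  nonneg := by rintro q rfl; exact le_rfl
  le_end := by rintro q rfl; exact hT
  value_le := by rintro q rfl; simpa using hW
  mesh := by
    rintro q rfl s hs _
    exact ⟨_, rfl, by simp only at *; linarith, hs⟩
  descent := by
    rintro q rfl q' rfl
    simp

lemma sUnion {S : Set (Set (ℝ × E × ℝ))} (hne : S.Nonempty) (hS : IsChain (· ⊆ ·) S)
    (h : ∀ Γ ∈ S, IsDescentSet L W T x₀ w₀ δ Γ) : IsDescentSet L W T x₀ w₀ δ (⋃₀ S) where
  start_mem := by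
    obtain ⟨Γ, hΓ⟩ := hne
    exact ⟨Γ, hΓ, (h Γ hΓ).start_mem⟩
  eq_start := by
    rintro q ⟨Γ, hΓ, hq⟩
    exact (h Γ hΓ).eq_start q hq
  nonneg := by
    rintro q ⟨Γ, hΓ, hq⟩
    exact (h Γ hΓ).nonneg q hq
  le_end := by
    rintro q ⟨Γ, hΓ, hq⟩
    exact (h Γ hΓ).le_end q hq
  value_le := by
    rintro q ⟨Γ, hΓ, hq⟩
    exact (h Γ hΓ).value_le q hq
  mesh := by
    rintro q ⟨Γ, hΓ, hq⟩ s hs hsq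
    obtain ⟨r, hr, h1⟩ := (h Γ hΓ).mesh q hq s hs hsq
    exact ⟨r, ⟨Γ, hΓ, hr⟩, h1⟩
  descent := by
    rintro q ⟨Γ, hΓ, hq⟩ q' ⟨Γ', hΓ', hq'⟩ hqq X p c hm hX
    rcases hS.total hΓ hΓ' with hsub | hsub
    · exact (h Γ' hΓ').descent q (hsub hq) q' hq' hqq X p c hm
        fun r hr => hX r ⟨Γ', hΓ', hr⟩
    · exact (h Γ hΓ).descent q hq q' (hsub hq') hqq X p c hm
        fun r hr => hX r ⟨Γ, hΓ, hr⟩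

lemma insert (h : IsDescentSet L W T x₀ w₀ δ Γ) (hδ : 0 ≤ δ) {z : ℝ × E × ℝ}
    (hlt : ∀ q ∈ Γ, q.1 < z.1) (hzT : z.1 ≤ T) (hz : W (T - z.1, z.2.1) ≤ (z.2.2 : EReal))
    (hmesh : ∀ s, 0 ≤ s → s < z.1 → ∃ r ∈ Γ, s - δ ≤ r.1 ∧ r.1 ≤ s)
    (hdesc : ∀ q ∈ Γ, ∀ X p c, IsAffineMinorant L X p c →
      (∀ r ∈ Γ, q.1 ≤ r.1 → r.2.1 ∈ X) →
      c * (z.1 - q.1) + p (z.2.1 - q.2.1) ≤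
        q.2.2 - z.2.2 + δ * (1 + ‖p‖ + |c|) * (z.1 - q.1)) :
    IsDescentSet L W T x₀ w₀ δ (insert z Γ) where
  start_mem := Or.inr h.start_mem
  eq_start := by
    rintro q (rfl | hq) h0
    · exact absurd (hlt _ h.start_mem) (not_lt.2 h0)
    · exact h.eq_start q hq h0
  nonneg := by
    rintro q (rfl | hq)
    · exact (hlt _ h.start_mem).le
    · exact h.nonneg q hq
  le_end := by
    rintro q (rfl | hq)
    · exact hzT
    · exact h.le_end q hq
  value_le := by
    rintro q (rfl | hq)
    · exact hz
    · exact h.value_le q hq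
  mesh := by
    rintro q (rfl | hq) s hs hsq
    · rcases hsq.lt_or_eq with h1 | rfl
      · obtain ⟨r, hr, h2⟩ := hmesh s hs h1
        exact ⟨r, Or.inr hr, h2⟩
      · exact ⟨q, Or.inl rfl, by linarith, le_rfl⟩
    · obtain ⟨r, hr, h2⟩ := h.mesh q hq s hs hsq
      exact ⟨r, Or.inr hr, h2⟩
  descent := by
    rintro q (rfl | hq) q' (rfl | hq') hqq X p c hm hX
    · simp
    · exact absurd (hlt _ hq') (not_lt.2 hqq)
    · exact hdesc q hq X p c hm fun r hr h1 => hX r (Or.inr hr) h1 (hlt r hr).le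
    · exact h.descent q hq q' hq' hqq X p c hm fun r hr => hX r (Or.inr hr)

lemma mul_norm_sub_le (h : IsDescentSet L W T x₀ w₀ δ Γ) (hδ : 0 ≤ δ) {M C : ℝ} (hM : 0 ≤ M)
    (hC : 0 ≤ C) (hMC : ∀ p : E →L[ℝ] ℝ, ‖p‖ ≤ M → IsAffineMinorant L univ p (-C))
    {q q' : ℝ × E × ℝ} (hq : q ∈ Γ) (hq' : q' ∈ Γ) (hqq : q.1 ≤ q'.1) :
    M * ‖q'.2.1 - q.2.1‖ ≤ q.2.2 - q'.2.2 + (C + δ * (1 + M + C)) * (q'.1 - q.1) := by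
  refine mul_norm_le_of_forall_dual_le hM fun p hp => ?_
  have h1 := h.descent q hq q' hq' hqq univ p (-C) (hMC p hp) (fun _ _ _ _ => mem_univ _)
  rw [abs_neg, abs_of_nonneg hC] at h1
  have h2 : δ * (1 + ‖p‖ + C) * (q'.1 - q.1) ≤ δ * (1 + M + C) * (q'.1 - q.1) := by
    have : 0 ≤ q'.1 - q.1 := by linarith
    gcongr
  linarith

end IsDescentSet

lemma LowerSemicontinuousOn.le_of_tendsto_real {α ι : Type*} [TopologicalSpace α] {f : α → EReal}
    {S : Set α} (hf : LowerSemicontinuousOn f S) {l : Filter ι} [l.NeBot] {z : ι → α} {z₀ : α}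
    (hz : Tendsto z l (𝓝 z₀)) (hzS : ∀ i, z i ∈ S) (hz₀ : z₀ ∈ S) {g : ι → ℝ} {g₀ : ℝ}
    (hg : Tendsto g l (𝓝 g₀)) (hle : ∀ i, f (z i) ≤ (g i : EReal)) : f z₀ ≤ (g₀ : EReal) := by
  by_contra! hlt
  obtain ⟨b, hb1, hb2⟩ := exists_between hlt
  have h1 : ∀ᶠ i in l, b < f (z i) :=
    (tendsto_nhdsWithin_iff.2 ⟨hz, Eventually.of_forall hzS⟩).eventually (hf z₀ hz₀ b hb2)
  have h2 : ∀ᶠ i in l, (g i : EReal) < b :=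
    ((continuous_coe_real_ereal.tendsto g₀).comp hg).eventually (gt_mem_nhds hb1)
  obtain ⟨i, hi1, hi2⟩ := (h1.and h2).exists
  exact absurd (hi1.trans_le (hle i)) (not_lt.2 hi2.le)

lemma exists_descent_of_Dup_le {W : ℝ × E → EReal} (hW0 : ∀ q, 0 ≤ W q) {t : ℝ} {x u : E}
    {ω ℓ ε : ℝ} (hω : W (t, x) = (ω : EReal)) (hε : 0 < ε)
    (hD : Dup W (t, x) ((-1 : ℝ), u) ≤ ((-ℓ : ℝ) : EReal)) :
    ∃ h : ℝ, 0 < h ∧ h < ε ∧ ∃ b : ℝ, |b + 1| < ε ∧ ∃ v : E, ‖v - u‖ < ε ∧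
      W (t + h * b, x + h • v) ≤ ((ω - h * (ℓ - ε) : ℝ) : EReal) := by
  have h1 : Dup W (t, x) ((-1 : ℝ), u) < ((-ℓ + ε : ℝ) : EReal) :=
    hD.trans_lt (by exact_mod_cast (by linarith : -ℓ < -ℓ + ε))
  have h2 := frequently_lt_of_liminf_lt (by isBoundedDefault) h1
  have h3 : ∀ᶠ p : ℝ × (ℝ × E) in (𝓝[>] (0 : ℝ)) ×ˢ 𝓝 ((-1 : ℝ), u),
      p.1 ∈ Ioo 0 ε ∧ p.2 ∈ ball ((-1 : ℝ), u) ε :=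
    Eventually.prod_mk (Ioo_mem_nhdsGT hε) (ball_mem_nhds _ hε)
  obtain ⟨⟨h, b, v⟩, hlt, ⟨hh0, hhε⟩, hball⟩ := (h2.and_eventually h3).exists
  rw [mem_ball, Prod.dist_eq, max_lt_iff, Real.dist_eq, dist_eq_norm, sub_neg_eq_add] at hball
  refine ⟨h, hh0, hhε, b, hball.1, v, hball.2, ?_⟩
  simp only [Prod.smul_mk, Prod.mk_add_mk, smul_eq_mul, hω] at hlt
  have hW := hW0 (t + h * b, x + h • v)
  have hinv : 0 < h⁻¹ := inv_pos.2 hh0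
  induction hw : W (t + h * b, x + h • v) with
  | bot => exact bot_le
  | top =>
    rw [hw, EReal.top_sub_coe, EReal.coe_mul_top_of_pos hinv] at hlt
    exact absurd hlt not_top_lt
  | coe y =>
    rw [hw] at hlt
    norm_cast at hlt ⊢
    rw [inv_mul_lt_iff₀ hh0] at hlt
    linarith

namespace IsDescentSet

variable {L : E → E → ℝ} {W : ℝ × E → EReal} {T : ℝ} {x₀ : E} {w₀ δ : ℝ} {Γ : Set (ℝ × E × ℝ)}

lemma value_nonneg (h : IsDescentSet L W T x₀ w₀ δ Γ) (hW0 : ∀ q, 0 ≤ W q)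
    {q : ℝ × E × ℝ} (hq : q ∈ Γ) : 0 ≤ q.2.2 := by
  have := (hW0 _).trans (h.value_le q hq)
  exact_mod_cast this

lemma exists_insert_of_unattained [CompleteSpace E] (h : IsDescentSet L W T x₀ w₀ δ Γ)
    (hδ : 0 ≤ δ) (hcoer : UniformlyCoercive L) (hW0 : ∀ q, 0 ≤ W q)
    (hWlsc : LowerSemicontinuousOn W {q : ℝ × E | 0 ≤ q.1})
    (hsup : ∀ q ∈ Γ, ∃ q' ∈ Γ, q.1 < q'.1) :
    ∃ z ∉ Γ, IsDescentSet L W T x₀ w₀ δ (Insert.insert z Γ) := by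
  have hne : (Prod.fst '' Γ).Nonempty := ⟨_, _, h.start_mem, rfl⟩
  have hbdd : BddAbove (Prod.fst '' Γ) := ⟨T, by rintro _ ⟨q, hq, rfl⟩; exact h.le_end q hq⟩
  obtain ⟨s, hsm, hs, hmem⟩ := exists_seq_tendsto_sSup hne hbdd
  set S := sSup (Prod.fst '' Γ)
  choose q hqΓ hqs using hmem
  have hlt : ∀ r ∈ Γ, r.1 < S := fun r hr => by
    obtain ⟨r', hr', hrr⟩ := hsup r hr
    exact hrr.trans_le (le_csSup hbdd ⟨r', hr', rfl⟩)
  have hST : S ≤ T := csSup_le hne (by rintro _ ⟨r, hr, rfl⟩; exact h.le_end r hr)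
  obtain ⟨C, hC, hMC⟩ := hcoer.exists_isAffineMinorant 1
  set K := C + δ * (1 + 1 + C)
  have hK : 0 ≤ K := by positivity
  set g : ℕ → ℝ := fun i => (q i).2.2 - K * s i
  have hg : ∀ i j, i ≤ j → ‖(q j).2.1 - (q i).2.1‖ ≤ g i - g j := by
    intro i j hij
    have := h.mul_norm_sub_le hδ zero_le_one hC hMC (hqΓ i) (hqΓ j)
      (by rw [hqs, hqs]; exact hsm hij)
    rw [hqs, hqs, one_mul] at this
    simp only [g]
    linarith
  have hganti : Antitone g := fun i j hij => by
    have := (norm_nonneg _).trans (hg i j hij)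
    linarith
  have hgbdd : BddBelow (range g) := by
    refine ⟨-(K * T), ?_⟩
    rintro _ ⟨i, rfl⟩
    have h1 := h.value_nonneg hW0 (hqΓ i)
    have h2 : K * s i ≤ K * T := by
      have := h.le_end _ (hqΓ i)
      rw [hqs] at this
      gcongr
    simp only [g]
    linarith
  have hglim := tendsto_atTop_ciInf hganti hgbdd
  have hcauchy : CauchySeq fun i => (q i).2.1 := by
    rw [Metric.cauchySeq_iff']
    intro ε hε
    obtain ⟨N, hN⟩ := Metric.cauchySeq_iff'.1 hglim.cauchySeq ε hε
    refine ⟨N, fun i hi => ?_⟩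
    rw [dist_eq_norm]
    refine (hg N i hi).trans_lt ?_
    have := hN i hi
    rw [Real.dist_eq, abs_sub_comm] at this
    exact (le_abs_self _).trans_lt this
  obtain ⟨x, hx⟩ := cauchySeq_tendsto_of_complete hcauchy
  obtain ⟨w, hw⟩ : ∃ w, Tendsto (fun i => (q i).2.2) atTop (𝓝 w) := by
    refine ⟨iInf g + K * S, (hglim.add (hs.const_mul K)).congr fun i => ?_⟩
    simp only [g]
    ring
  refine ⟨(S, x, w), fun hz => (hlt _ hz).false, h.insert hδ hlt hST ?_ ?_ ?_⟩
  · refine hWlsc.le_of_tendsto_real (l := atTop) (z := fun i => (T - (q i).1, (q i).2.1)) ?_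
      (fun i => sub_nonneg.2 (h.le_end _ (hqΓ i))) (sub_nonneg.2 hST) hw
      (fun i => h.value_le _ (hqΓ i))
    simp only [hqs]
    exact (tendsto_const_nhds.sub hs).prodMk_nhds hx
  · intro s' hs' hs'S
    obtain ⟨i, hi⟩ := (hs.eventually (lt_mem_nhds hs'S)).exists
    exact h.mesh _ (hqΓ i) s' hs' (by rw [hqs]; exact hi.le)
  · intro r hr X p c hm hX
    have h1 : Tendsto (fun i => (q i).1 - r.1) atTop (𝓝 (S - r.1)) := by
      simp only [hqs]
      exact hs.sub_const _
    have h2 : Tendsto (fun i => p ((q i).2.1 - r.2.1)) atTop (𝓝 (p (x - r.2.1))) :=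
      (p.continuous.tendsto _).comp (hx.sub_const _)
    refine le_of_tendsto_of_tendsto ((h1.const_mul c).add h2)
      ((hw.const_sub r.2.2).add (h1.const_mul _)) ?_
    filter_upwards [hs.eventually (lt_mem_nhds (hlt r hr))] with i hi
    exact h.descent r hr _ (hqΓ i) (by rw [hqs]; exact hi.le) X p c hm
      fun r' hr' h3 _ => hX r' hr' h3

lemma exists_insert_of_attained (h : IsDescentSet L W T x₀ w₀ δ Γ) (hδ : 0 < δ)
    (hW0 : ∀ q, 0 ≤ W q)
    (hstep : ∀ t x, 0 < t → W (t, x) ≠ ⊤ →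
      ∃ u, Dup W (t, x) ((-1 : ℝ), u) ≤ ((-(L x u) : ℝ) : EReal))
    {q : ℝ × E × ℝ} (hq : q ∈ Γ) (hmax : ∀ r ∈ Γ, r.1 ≤ q.1) (hqT : q.1 < T) :
    ∃ z ∉ Γ, IsDescentSet L W T x₀ w₀ δ (Insert.insert z Γ) := by
  obtain ⟨s, x, w⟩ := q
  simp only at hmax hqT
  have hWw : W (T - s, x) ≤ (w : EReal) := h.value_le _ hq
  have hWtop : W (T - s, x) ≠ ⊤ := (hWw.trans_lt (EReal.coe_lt_top w)).ne
  obtain ⟨u, hu⟩ := hstep _ _ (sub_pos.2 hqT) hWtop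
  have hWbot : W (T - s, x) ≠ ⊥ := (EReal.bot_lt_zero.trans_le (hW0 _)).ne'
  have hω : W (T - s, x) = ((W (T - s, x)).toReal : EReal) := (EReal.coe_toReal hWtop hWbot).symm
  set ω := (W (T - s, x)).toReal
  have hωw : ω ≤ w := by rw [hω] at hWw; exact_mod_cast hWw
  obtain ⟨ε, hε, hεm⟩ : ∃ ε : ℝ, 0 < ε ∧ ε ≤ 1 / 2 ∧ ε ≤ δ / 2 ∧ ε ≤ (T - s) / 2 := by
    refine ⟨min (1 / 2) (min (δ / 2) ((T - s) / 2)), ?_, min_le_left _ _, ?_, ?_⟩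
    · have := sub_pos.2 hqT
      positivity
    · exact (min_le_right _ _).trans (min_le_left _ _)
    · exact (min_le_right _ _).trans (min_le_right _ _)
  obtain ⟨hε1, hε2, hε3⟩ := hεm
  obtain ⟨k, hk0, hkε, b, hb, v, hv, hWk⟩ := exists_descent_of_Dup_le hW0 hω hε hu
  rw [abs_lt] at hb
  have hz1 : s < s - k * b := by nlinarith
  have hz2 : s - k * b < s + 2 * ε := by nlinarith
  have hzT : T - (s - k * b) = T - s + k * b := by ring
  refine ⟨(s - k * b, x + k • v, w - k * (L x u - ε)), fun hz => ?_, ?_⟩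
  · exact absurd (hmax _ hz) (not_le.2 hz1)
  refine h.insert hδ.le (fun r hr => (hmax r hr).trans_lt hz1) (by simp only; linarith) ?_ ?_ ?_
  · simp only [hzT]
    refine hWk.trans ?_
    exact_mod_cast (by linarith)
  · intro s' hs' hs'z
    simp only at hs'z
    rcases le_or_gt s' s with h1 | h1
    · exact h.mesh _ hq s' hs' h1
    · exact ⟨_, hq, by simp only; linarith, h1.le⟩
  · intro r hr X p c hm hX
    have h1 := h.descent r hr _ hq (hmax r hr) X p c hm fun r' hr' h1 _ => hX r' hr' h1
    have h2 := hm x (hX _ hq (hmax r hr)) u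
    have h3 : p v - p u ≤ ‖p‖ * ε := by
      rw [← map_sub]
      exact (le_abs_self _).trans ((p.le_opNorm _).trans (by gcongr))
    have h4 : c * (-b - 1) ≤ |c| * ε := by
      refine (le_abs_self _).trans ?_
      rw [abs_mul]
      have : |-b - 1| ≤ ε := abs_le.2 ⟨by linarith, by linarith⟩
      gcongr
    have h5 : ε * (1 + ‖p‖ + |c|) ≤ δ * (1 + ‖p‖ + |c|) * (-b) := by
      have h6 : 0 ≤ 1 + ‖p‖ + |c| := by positivity
      have : ε ≤ δ * (-b) := by nlinarith
      nlinarith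
    have h7 : c * (-b) + p v ≤ L x u - ε + δ * (1 + ‖p‖ + |c|) * (-b) := by linarith
    have h8 := mul_le_mul_of_nonneg_left h7 hk0.le
    have h9 : p (x + k • v - r.2.1) = p (x - r.2.1) + k * p v := by
      rw [add_sub_right_comm, map_add, map_smul, smul_eq_mul]
    simp only at h1 ⊢
    rw [h9]
    linarith

lemma exists_mem_end [CompleteSpace E] (hT : 0 ≤ T) (hδ : 0 < δ) (hcoer : UniformlyCoercive L)
    (hW0 : ∀ q, 0 ≤ W q) (hWlsc : LowerSemicontinuousOn W {q : ℝ × E | 0 ≤ q.1})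
    (hstep : ∀ t x, 0 < t → W (t, x) ≠ ⊤ →
      ∃ u, Dup W (t, x) ((-1 : ℝ), u) ≤ ((-(L x u) : ℝ) : EReal))
    (hW : W (T, x₀) ≤ (w₀ : EReal)) :
    ∃ Γ, IsDescentSet L W T x₀ w₀ δ Γ ∧ ∃ q ∈ Γ, q.1 = T := by
  obtain ⟨Γ, -, hΓ⟩ := zorn_subset_nonempty {Γ | IsDescentSet L W T x₀ w₀ δ Γ}
    (fun S hS hch hne => ⟨⋃₀ S, sUnion hne hch hS, fun _ => subset_sUnion_of_mem⟩) _
    (singleton hT hδ.le hW)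
  have hmax : ¬ ∃ z ∉ Γ, IsDescentSet L W T x₀ w₀ δ (Insert.insert z Γ) := by
    rintro ⟨z, hz, hins⟩
    exact hz (hΓ.2 hins (subset_insert z Γ) (mem_insert z Γ))
  refine ⟨Γ, hΓ.1, ?_⟩
  by_contra! hend
  by_cases hatt : ∃ q ∈ Γ, ∀ r ∈ Γ, r.1 ≤ q.1
  · obtain ⟨q, hq, hqmax⟩ := hatt
    exact hmax (hΓ.1.exists_insert_of_attained hδ hW0 hstep hq hqmax
      (lt_of_le_of_ne (hΓ.1.le_end q hq) (hend q hq)))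
  · push Not at hatt
    exact hmax (hΓ.1.exists_insert_of_unattained hδ.le hcoer hW0 hWlsc hatt)

end IsDescentSet

/-- A path `y` on `[0, T]` along which `w` bounds the value and decreases at least as fast as every
affine minorant of the Lagrangian prescribes. -/
structure IsDescentPath (L : E → E → ℝ) (W : ℝ × E → EReal) (T : ℝ) (x₀ : E) (w₀ : ℝ)
    (y : ℝ → E) (w : ℝ → ℝ) : Prop where
  start_eq : y 0 = x₀
  start_value : w 0 = w₀
  end_value : W (0, y T) ≤ (w T : EReal)
  descent : ∀ p c, IsAffineMinorant L univ p c → ∀ a b, 0 ≤ a → a ≤ b → b ≤ T →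
    c * (b - a) + p (y b - y a) ≤ w a - w b
  local_descent : ∀ s, 0 ≤ s → s < T → ∀ r > 0, ∀ p c, IsAffineMinorant L (ball (y s) r) p c →
    ∀ᶠ b in 𝓝[>] s, c * (b - s) + p (y b - y s) ≤ w s - w b

lemma exists_isDescentPath [FiniteDimensional ℝ E] {L : E → E → ℝ} {W : ℝ × E → EReal} {T : ℝ}
    {x₀ : E} {w₀ : ℝ} (hT : 0 ≤ T) (hL0 : ∀ x u, 0 ≤ L x u) (hcoer : UniformlyCoercive L)
    (hW0 : ∀ q, 0 ≤ W q) (hWlsc : LowerSemicontinuousOn W {q : ℝ × E | 0 ≤ q.1})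
    (hstep : ∀ t x, 0 < t → W (t, x) ≠ ⊤ →
      ∃ u, Dup W (t, x) ((-1 : ℝ), u) ≤ ((-(L x u) : ℝ) : EReal))
    (hW : W (T, x₀) ≤ (w₀ : EReal)) :
    ∃ y w, IsDescentPath L W T x₀ w₀ y w := by
  have := FiniteDimensional.proper_real E
  have := FiniteDimensional.complete ℝ E
  set δ : ℕ → ℝ := fun k => 1 / ((k : ℝ) + 1)
  have hδ0 : ∀ k, 0 < δ k := fun k => by positivity
  have hδ1 : ∀ k, δ k ≤ 1 := fun k => by
    rw [div_le_one (by positivity)]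
    linarith [(Nat.cast_nonneg k : (0 : ℝ) ≤ k)]
  choose Γ hΓ e heΓ heT using fun k =>
    IsDescentSet.exists_mem_end hT (hδ0 k) hcoer hW0 hWlsc hstep hW
  have hpick : ∀ s, ∃ q : ℕ → ℝ × E × ℝ, s ∈ Icc 0 T → ∀ k, q k ∈ Γ k ∧
      s - δ k ≤ (q k).1 ∧ (q k).1 ≤ s := by
    intro s
    by_cases hs : s ∈ Icc 0 T
    · choose q hq using fun k => (hΓ k).mesh (e k) (heΓ k) s hs.1 (by rw [heT]; exact hs.2)
      exact ⟨q, fun _ => hq⟩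
    · exact ⟨fun _ => (0, x₀, w₀), fun h => absurd h hs⟩
  choose q hq using hpick
  obtain ⟨U, hU⟩ : ∃ U : Ultrafilter ℕ, (U : Filter ℕ) ≤ atTop := Ultrafilter.exists_le atTop
  have hδU : Tendsto δ U (𝓝 0) := tendsto_one_div_add_atTop_nhds_zero_nat.mono_left hU
  have hwbd : ∀ k, ∀ r ∈ Γ k, 0 ≤ r.2.2 ∧ r.2.2 ≤ w₀ + T := by
    intro k r hr
    refine ⟨(hΓ k).value_nonneg hW0 hr, ?_⟩
    have h1 := (hΓ k).descent _ (hΓ k).start_mem r hr ((hΓ k).nonneg r hr) univ 0 0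
      (fun x _ u => by simpa using hL0 x u) (fun _ _ _ _ => mem_univ _)
    simp only [zero_mul, norm_zero, abs_zero, add_zero, mul_one, sub_zero,
      zero_apply] at h1
    have h2 := (hΓ k).le_end r hr
    have h3 := (hΓ k).nonneg r hr
    nlinarith [hδ1 k, hδ0 k]
  have hdisp : ∀ M : ℝ, 0 ≤ M → ∃ K, 0 ≤ K ∧ ∀ k, ∀ r ∈ Γ k, ∀ r' ∈ Γ k, r.1 ≤ r'.1 →
      M * ‖r'.2.1 - r.2.1‖ ≤ w₀ + T + K * (r'.1 - r.1) := by
    intro M hM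
    obtain ⟨C, hC, hMC⟩ := hcoer.exists_isAffineMinorant M
    refine ⟨C + (1 + M + C), by positivity, fun k r hr r' hr' hrr => ?_⟩
    have h1 := (hΓ k).mul_norm_sub_le (hδ0 k).le hM hC hMC hr hr' hrr
    have h2 : (C + δ k * (1 + M + C)) * (r'.1 - r.1) ≤ (C + (1 + M + C)) * (r'.1 - r.1) := by
      have := sub_nonneg.2 hrr
      have := mul_le_of_le_one_left (by positivity : 0 ≤ 1 + M + C) (hδ1 k)
      gcongr
    linarith [(hwbd k r hr).2, (hwbd k r' hr').1]
  have hlim : ∀ s, ∃ z : E × ℝ, s ∈ Icc 0 T → Tendsto (fun k => (q s k).2) U (𝓝 z) := by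
    intro s
    by_cases hs : s ∈ Icc 0 T
    · obtain ⟨K, hK, hKd⟩ := hdisp 1 zero_le_one
      have hcpt : IsCompact (closedBall x₀ (w₀ + T + K * T) ×ˢ Icc (0 : ℝ) (w₀ + T)) :=
        (isCompact_closedBall _ _).prod isCompact_Icc
      obtain ⟨z, -, hz⟩ := hcpt.ultrafilter_le_nhds (U.map fun k => (q s k).2) (by
        rw [le_principal_iff, Ultrafilter.coe_map, mem_map]
        refine Filter.univ_mem' fun k => ?_
        have hqk := (hq s hs k).1
        refine ⟨?_, hwbd k _ hqk⟩
        have h1 := hKd k _ (hΓ k).start_mem _ hqk ((hΓ k).nonneg _ hqk)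
        rw [mem_closedBall, dist_eq_norm]
        simp only [one_mul, sub_zero] at h1
        have : K * (q s k).1 ≤ K * T := by
          have := (hΓ k).le_end _ hqk
          gcongr
        linarith)
      exact ⟨z, fun _ => hz⟩
    · exact ⟨(x₀, w₀), fun h => absurd h hs⟩
  choose z hz using hlim
  have htime : ∀ s ∈ Icc 0 T, Tendsto (fun k => (q s k).1) U (𝓝 s) := by
    intro s hs
    refine tendsto_of_tendsto_of_tendsto_of_le_of_le (g := fun k => s - δ k) ?_ tendsto_const_nhds
      (fun k => (hq s hs k).2.1) (fun k => (hq s hs k).2.2)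
    simpa using hδU.const_sub s
  have hstate : ∀ s ∈ Icc 0 T, Tendsto (fun k => (q s k).2.1) U (𝓝 (z s).1) :=
    fun s hs => (hz s hs).fst_nhds
  have hvalue : ∀ s ∈ Icc 0 T, Tendsto (fun k => (q s k).2.2) U (𝓝 (z s).2) :=
    fun s hs => (hz s hs).snd_nhds
  have hdesc : ∀ a ∈ Icc 0 T, ∀ b ∈ Icc 0 T, a < b → ∀ X p c, IsAffineMinorant L X p c →
      (∀ᶠ k in (U : Filter ℕ), ∀ r ∈ Γ k, (q a k).1 ≤ r.1 → r.1 ≤ (q b k).1 → r.2.1 ∈ X) →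
      c * (b - a) + p ((z b).1 - (z a).1) ≤ (z a).2 - (z b).2 := by
    intro a ha b hb hab X p c hm hX
    have h1 := (htime b hb).sub (htime a ha)
    have h2 : Tendsto (fun k => p ((q b k).2.1 - (q a k).2.1)) U (𝓝 (p ((z b).1 - (z a).1))) :=
      (p.continuous.tendsto _).comp ((hstate b hb).sub (hstate a ha))
    have h3 := ((hvalue a ha).sub (hvalue b hb)).add
      ((hδU.mul_const (1 + ‖p‖ + |c|)).mul h1)
    rw [zero_mul, zero_mul, add_zero] at h3
    refine le_of_tendsto_of_tendsto ((h1.const_mul c).add h2) h3 ?_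
    filter_upwards [hX, (htime a ha).eventually_lt (htime b hb) hab] with k hk hlt
    exact (hΓ k).descent _ (hq a ha k).1 _ (hq b hb k).1 hlt.le X p c hm hk
  have h0T : (0 : ℝ) ∈ Icc 0 T := ⟨le_rfl, hT⟩
  have hTT : T ∈ Icc 0 T := ⟨hT, le_rfl⟩
  have hq0 : ∀ k, q 0 k = (0, x₀, w₀) := fun k =>
    (hΓ k).eq_start _ (hq 0 h0T k).1 (hq 0 h0T k).2.2
  refine ⟨fun s => (z s).1, fun s => (z s).2, ?_, ?_, ?_, ?_, ?_⟩
  · have := hstate 0 h0T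
    simp only [hq0] at this
    exact (tendsto_nhds_unique this tendsto_const_nhds)
  · have := hvalue 0 h0T
    simp only [hq0] at this
    exact (tendsto_nhds_unique this tendsto_const_nhds)
  · refine hWlsc.le_of_tendsto_real (z := fun k => (T - (q T k).1, (q T k).2.1)) ?_
      (fun k => sub_nonneg.2 ((hΓ k).le_end _ (hq T hTT k).1)) (mem_ofPred.2 le_rfl) (hvalue T hTT)
      (fun k => (hΓ k).value_le _ (hq T hTT k).1)
    refine Tendsto.prodMk_nhds ?_ (hstate T hTT)
    simpa using (htime T hTT).const_sub T
  · intro p c hm a b ha hab hb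
    rcases hab.eq_or_lt with rfl | hlt
    · simp
    · exact hdesc a ⟨ha, hab.trans hb⟩ b ⟨ha.trans hab, hb⟩ hlt univ p c hm
        (Eventually.of_forall fun _ _ _ _ _ => mem_univ _)
  · intro s hs0 hsT r hr p c hm
    have hs : s ∈ Icc 0 T := ⟨hs0, hsT.le⟩
    have hB : 0 ≤ w₀ + T := (hwbd 0 _ (hΓ 0).start_mem).1.trans (hwbd 0 _ (hΓ 0).start_mem).2
    set M := (w₀ + T + 1) / (r / 2)
    have hM : 0 < M := by positivity
    have hMr : M * (r / 2) = w₀ + T + 1 := div_mul_cancel₀ _ (by positivity)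
    obtain ⟨K, hK, hKd⟩ := hdisp M hM.le
    have hKb : ∀ᶠ b in 𝓝[>] s, K * (b - s) < 1 := by
      have : Tendsto (fun b => K * (b - s)) (𝓝[>] s) (𝓝 (K * (s - s))) :=
        (Continuous.tendsto (by fun_prop) s).mono_left nhdsWithin_le_nhds
      rw [sub_self, mul_zero] at this
      exact this.eventually (gt_mem_nhds one_pos)
    filter_upwards [hKb, Ioo_mem_nhdsGT hsT] with b hKb hb
    have hb' : b ∈ Icc 0 T := ⟨hs0.trans hb.1.le, hb.2.le⟩
    refine hdesc s hs b hb' hb.1 _ p c hm ?_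
    have h1 := ((htime b hb').sub (htime s hs)).const_mul K
    filter_upwards [h1.eventually (gt_mem_nhds hKb),
      (hstate s hs).eventually (ball_mem_nhds _ (half_pos hr))] with k hk1 hk2 r' hr' hsr hrb
    have h2 := hKd k _ (hq s hs k).1 r' hr' hsr
    have h3 : K * (r'.1 - (q s k).1) ≤ K * ((q b k).1 - (q s k).1) := by gcongr
    have h4 : ‖r'.2.1 - (q s k).2.1‖ < r / 2 := lt_of_mul_lt_mul_left (by linarith) hM.le
    rw [← dist_eq_norm] at h4
    have hk2 : dist (q s k).2.1 (z s).1 < r / 2 := hk2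
    rw [mem_ball]
    linarith [dist_triangle r'.2.1 (q s k).2.1 (z s).1]

open AbsolutelyContinuousOnInterval in
lemma MonotoneOn.sum_dist_le_of_mem_disjWithin_s15 {g : ℝ → ℝ} {a b : ℝ} (hab : a ≤ b)
    (hg : MonotoneOn g (Icc a b)) {D : ℕ × (ℕ → ℝ × ℝ)} (hD : D ∈ disjWithin a b) :
    ∑ i ∈ Finset.range D.1, dist (g (D.2 i).1) (g (D.2 i).2) ≤ g b - g a := by
  obtain ⟨hmem, hdis⟩ := hD
  rw [uIcc_of_le hab] at hmem
  have hgab : g a ≤ g b := hg ⟨le_rfl, hab⟩ ⟨hab, le_rfl⟩ hab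
  have hdis' : Set.PairwiseDisjoint (Finset.range D.1 : Set ℕ)
      (fun i => uIoc (g (D.2 i).1) (g (D.2 i).2)) := by
    intro i hi j hj hij
    have hd := hdis hi hj hij
    have hi' := hmem i hi
    have hj' := hmem j hj
    have hmin : ∀ k, (D.2 k).1 ∈ Icc a b ∧ (D.2 k).2 ∈ Icc a b →
        uIoc (g (D.2 k).1) (g (D.2 k).2) =
          Ioc (g (min (D.2 k).1 (D.2 k).2)) (g (max (D.2 k).1 (D.2 k).2)) := by
      intro k hk
      rcases le_total (D.2 k).1 (D.2 k).2 with h | h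
      · rw [min_eq_left h, max_eq_right h, uIoc_of_le (hg hk.1 hk.2 h)]
      · rw [min_eq_right h, max_eq_left h, uIoc_of_ge (hg hk.2 hk.1 h)]
    have hmM : ∀ k, (D.2 k).1 ∈ Icc a b ∧ (D.2 k).2 ∈ Icc a b →
        min (D.2 k).1 (D.2 k).2 ∈ Icc a b ∧ max (D.2 k).1 (D.2 k).2 ∈ Icc a b := by
      grind
    change Disjoint (uIoc _ _) (uIoc _ _)
    rw [hmin i hi', hmin j hj']
    change Disjoint (Ioc _ _) (Ioc _ _) at hd
    rw [Set.Ioc_disjoint_Ioc, min_le_iff, le_max_iff, le_max_iff] at hd ⊢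
    obtain ⟨hi1, hi2⟩ := hmM i hi'
    obtain ⟨hj1, hj2⟩ := hmM j hj'
    rcases hd with (h | h) | (h | h)
    · exact Or.inl (Or.inl (hg hi2 hi1 h))
    · exact Or.inl (Or.inr (hg hi2 hj1 h))
    · exact Or.inr (Or.inl (hg hj2 hi1 h))
    · exact Or.inr (Or.inr (hg hj2 hj1 h))
  have hsub : (⋃ i ∈ Finset.range D.1, uIoc (g (D.2 i).1) (g (D.2 i).2)) ⊆ Ioc (g a) (g b) := by
    refine iUnion₂_subset fun i hi => Ioc_subset_Ioc ?_ ?_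
    · exact le_inf (hg ⟨le_rfl, hab⟩ (hmem i hi).1 (hmem i hi).1.1)
        (hg ⟨le_rfl, hab⟩ (hmem i hi).2 (hmem i hi).2.1)
    · exact sup_le (hg (hmem i hi).1 ⟨hab, le_rfl⟩ (hmem i hi).1.2)
        (hg (hmem i hi).2 ⟨hab, le_rfl⟩ (hmem i hi).2.2)
  calc ∑ i ∈ Finset.range D.1, dist (g (D.2 i).1) (g (D.2 i).2)
      = ∑ i ∈ Finset.range D.1,
          MeasureTheory.volume.real (uIoc (g (D.2 i).1) (g (D.2 i).2)) := by
        refine Finset.sum_congr rfl fun i _ => ?_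
        rw [MeasureTheory.measureReal_def, Real.volume_uIoc, dist_comm, Real.dist_eq,
          ENNReal.toReal_ofReal (abs_nonneg _)]
    _ = MeasureTheory.volume.real
          (⋃ i ∈ Finset.range D.1, uIoc (g (D.2 i).1) (g (D.2 i).2)) := by
        rw [MeasureTheory.measureReal_biUnion_finset hdis' (fun _ _ => measurableSet_uIoc)
          (fun _ _ => by rw [Real.volume_uIoc]; exact ENNReal.ofReal_ne_top)]
    _ ≤ MeasureTheory.volume.real (Ioc (g a) (g b)) :=
        MeasureTheory.measureReal_mono hsub (by rw [Real.volume_Ioc]; exact ENNReal.ofReal_ne_top)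
    _ = g b - g a := Real.volume_real_Ioc_of_le hgab

lemma AbsolutelyContinuousOnInterval.of_dist_le {X : Type*} [PseudoMetricSpace X] {f : ℝ → X}
    {g : ℝ → ℝ} {a b : ℝ} (hab : a ≤ b) (hg : MonotoneOn g (Icc a b))
    (h : ∀ ε > 0, ∃ K, 0 ≤ K ∧ ∀ s t, a ≤ s → s ≤ t → t ≤ b →
      dist (f s) (f t) ≤ ε * (g t - g s) + K * (t - s)) :
    AbsolutelyContinuousOnInterval f a b := by
  rw [absolutelyContinuousOnInterval_iff]
  intro ε hε
  have hV : 0 ≤ g b - g a := sub_nonneg.2 (hg ⟨le_rfl, hab⟩ ⟨hab, le_rfl⟩ hab)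
  obtain ⟨K, hK, hfK⟩ := h (ε / (2 * (g b - g a + 1))) (by positivity)
  refine ⟨ε / (2 * (K + 1)), by positivity, fun D hD hlen => ?_⟩
  have hsum := hg.sum_dist_le_of_mem_disjWithin_s15 hab hD
  have hmem := hD.1
  rw [uIcc_of_le hab] at hmem
  have hterm : ∀ i ∈ Finset.range D.1, dist (f (D.2 i).1) (f (D.2 i).2) ≤
      ε / (2 * (g b - g a + 1)) * dist (g (D.2 i).1) (g (D.2 i).2) +
        K * dist (D.2 i).1 (D.2 i).2 := by
    intro i hi
    obtain ⟨h1, h2⟩ := hmem i hi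
    rcases le_total (D.2 i).1 (D.2 i).2 with hle | hle
    · rw [dist_comm (g _), dist_comm (D.2 i).1, Real.dist_eq, Real.dist_eq,
        abs_of_nonneg (sub_nonneg.2 hle), abs_of_nonneg (sub_nonneg.2 (hg h1 h2 hle))]
      exact hfK _ _ h1.1 hle h2.2
    · rw [dist_comm (f _), Real.dist_eq, Real.dist_eq,
        abs_of_nonneg (sub_nonneg.2 hle), abs_of_nonneg (sub_nonneg.2 (hg h2 h1 hle))]
      exact hfK _ _ h2.1 hle h1.2
  have h1 : ε / (2 * (g b - g a + 1)) * (g b - g a) < ε / 2 := by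
    rw [div_mul_eq_mul_div, div_lt_div_iff₀ (by positivity) two_pos]
    nlinarith
  have h2 : K * (ε / (2 * (K + 1))) ≤ ε / 2 := by
    rw [mul_div_assoc', div_le_div_iff₀ (by positivity) two_pos]
    nlinarith
  calc _ ≤ _ := Finset.sum_le_sum hterm
    _ = ε / (2 * (g b - g a + 1)) * ∑ i ∈ Finset.range D.1, dist (g (D.2 i).1) (g (D.2 i).2) +
        K * ∑ i ∈ Finset.range D.1, dist (D.2 i).1 (D.2 i).2 := by
      rw [Finset.sum_add_distrib, Finset.mul_sum, Finset.mul_sum]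
    _ ≤ ε / (2 * (g b - g a + 1)) * (g b - g a) + K * (ε / (2 * (K + 1))) := by gcongr
    _ < ε := by linarith

lemma AbsolutelyContinuousOnInterval.clm_comp {f : ℝ → E} {a b : ℝ}
    (hf : AbsolutelyContinuousOnInterval f a b) (p : E →L[ℝ] ℝ) :
    AbsolutelyContinuousOnInterval (fun s => p (f s)) a b := by
  rw [absolutelyContinuousOnInterval_iff] at hf ⊢
  intro ε hε
  obtain ⟨δ, hδ, h⟩ := hf (ε / (‖p‖ + 1)) (by positivity)
  refine ⟨δ, hδ, fun D hD hlen => ?_⟩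
  have hD' := h D hD hlen
  rw [lt_div_iff₀ (by positivity)] at hD'
  have hsum : ∑ i ∈ Finset.range D.1, dist (p (f (D.2 i).1)) (p (f (D.2 i).2)) ≤
      ‖p‖ * ∑ i ∈ Finset.range D.1, dist (f (D.2 i).1) (f (D.2 i).2) := by
    rw [Finset.mul_sum]
    refine Finset.sum_le_sum fun i _ => ?_
    rw [dist_eq_norm, dist_eq_norm, ← map_sub]
    exact p.le_opNorm _
  have h0 : 0 ≤ ∑ i ∈ Finset.range D.1, dist (f (D.2 i).1) (f (D.2 i).2) :=
    Finset.sum_nonneg fun _ _ => dist_nonneg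
  linarith

lemma HasDerivAt.nonpos_of_eventually_le {F : ℝ → ℝ} {F' s : ℝ} (hF : HasDerivAt F F' s)
    (h : ∀ᶠ b in 𝓝[>] s, F b ≤ F s) : F' ≤ 0 := by
  have h1 := (hasDerivWithinAt_iff_tendsto_slope' (s := Ioi s) (by simp)).1 hF.hasDerivWithinAt
  refine le_of_tendsto h1 ?_
  filter_upwards [h, self_mem_nhdsWithin] with b hb hsb
  rw [slope_def_field]
  exact div_nonpos_of_nonpos_of_nonneg (by linarith) (sub_nonneg.2 (le_of_lt hsb))

namespace IsDescentPath

variable {L : E → E → ℝ} {W : ℝ × E → EReal} {T : ℝ} {x₀ : E} {w₀ : ℝ} {y : ℝ → E} {w : ℝ → ℝ}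

lemma monotoneOn_neg (h : IsDescentPath L W T x₀ w₀ y w) (hL0 : ∀ x u, 0 ≤ L x u) :
    MonotoneOn (fun s => -w s) (Icc 0 T) := by
  intro a ha b hb hab
  have := h.descent 0 0 (fun x _ u => by simpa using hL0 x u) a b ha.1 hab hb.2
  simp only [zero_mul, zero_apply, add_zero] at this
  simp only
  linarith

lemma absolutelyContinuousOnInterval (h : IsDescentPath L W T x₀ w₀ y w) (hT : 0 ≤ T)
    (hL0 : ∀ x u, 0 ≤ L x u) (hcoer : UniformlyCoercive L) :
    AbsolutelyContinuousOnInterval y 0 T := by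
  refine .of_dist_le hT (h.monotoneOn_neg hL0) fun ε hε => ?_
  obtain ⟨C, hC, hMC⟩ := hcoer.exists_isAffineMinorant ε⁻¹
  refine ⟨ε * C, by positivity, fun s t hs hst ht => ?_⟩
  have h1 : ε⁻¹ * ‖y t - y s‖ ≤ w s - w t + C * (t - s) :=
    mul_norm_le_of_forall_dual_le (by positivity) fun p hp => by
      linarith [h.descent p (-C) (hMC p hp) s t hs hst ht]
  rw [inv_mul_le_iff₀ hε] at h1
  rw [dist_comm, dist_eq_norm]
  linarith

lemma lagrangian_le [FiniteDimensional ℝ E] (h : IsDescentPath L W T x₀ w₀ y w)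
    (hlsc : LowerSemicontinuous fun q : E × E => L q.1 q.2)
    (hconv : ∀ x, ConvexOn ℝ univ (L x)) (hcoer : UniformlyCoercive L) {s : ℝ}
    (hs0 : 0 ≤ s) (hsT : s < T) {v : E} (hy : HasDerivAt y v s) {w' : ℝ}
    (hw : HasDerivAt (fun s => -w s) w' s) : L (y s) v ≤ w' := by
  refine le_of_forall_lt fun a ha => ?_
  obtain ⟨a', ha1, ha2⟩ := exists_between ha
  obtain ⟨p, c, r, hr, hm, hle⟩ := exists_isAffineMinorant_ball hlsc hconv hcoer ha2
  have h1 : HasDerivAt (fun b => c * b + p (y b) - -w b) (c * 1 + p v - w') s :=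
    (((hasDerivAt_id s).const_mul c).add (p.hasFDerivAt.comp_hasDerivAt s hy)).sub hw
  have h2 := h1.nonpos_of_eventually_le (by
    filter_upwards [h.local_descent s hs0 hsT r hr p c hm] with b hb
    rw [map_sub] at hb
    linarith)
  linarith

lemma ae_lagrangian_le [FiniteDimensional ℝ E] (h : IsDescentPath L W T x₀ w₀ y w) (hT : 0 ≤ T)
    (hL0 : ∀ x u, 0 ≤ L x u) (hlsc : LowerSemicontinuous fun q : E × E => L q.1 q.2)
    (hconv : ∀ x, ConvexOn ℝ univ (L x)) (hcoer : UniformlyCoercive L) :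
    ∀ᵐ s, s ∈ Ioc 0 T → L (y s) (deriv y s) ≤ deriv (fun s => -w s) s := by
  filter_upwards [(h.absolutelyContinuousOnInterval hT hL0
    hcoer).boundedVariationOn.ae_differentiableAt_of_mem_uIcc,
    (h.monotoneOn_neg hL0).ae_differentiableWithinAt_of_mem,
    MeasureTheory.Measure.ae_ne MeasureTheory.volume T] with s hy hw hsT hs
  have hsT' : s < T := lt_of_le_of_ne hs.2 hsT
  rw [uIcc_of_le hT] at hy
  have hs' : s ∈ Icc 0 T := ⟨hs.1.le, hs.2⟩
  exact h.lagrangian_le hlsc hconv hcoer hs.1.le hsT' (hy hs').hasDerivAt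
    ((hw hs').differentiableAt (Icc_mem_nhds hs.1 hsT')).hasDerivAt

lemma intervalIntegrable_deriv [FiniteDimensional ℝ E] (h : IsDescentPath L W T x₀ w₀ y w)
    (hT : 0 ≤ T) (hL0 : ∀ x u, 0 ≤ L x u)
    (hlsc : LowerSemicontinuous fun q : E × E => L q.1 q.2)
    (hconv : ∀ x, ConvexOn ℝ univ (L x)) (hcoer : UniformlyCoercive L) :
    IntervalIntegrable (deriv y) MeasureTheory.volume 0 T := by
  have := FiniteDimensional.complete ℝ E
  have := FiniteDimensional.proper_real E
  obtain ⟨C, hC, hCL⟩ := hcoer 1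
  have hmono := h.monotoneOn_neg hL0
  rw [← uIcc_of_le hT] at hmono
  refine (hmono.intervalIntegrable_deriv.add (intervalIntegrable_const (c := C))).mono_fun'
    (aestronglyMeasurable_deriv _ _) ?_
  rw [uIoc_of_le hT, Filter.EventuallyLE, MeasureTheory.ae_restrict_iff' measurableSet_Ioc]
  filter_upwards [h.ae_lagrangian_le hT hL0 hlsc hconv hcoer] with s hs hsT
  have := hCL (y s) (deriv y s)
  linarith [hs hsT]

lemma add_integral_deriv_eq [FiniteDimensional ℝ E] (h : IsDescentPath L W T x₀ w₀ y w)
    (hT : 0 ≤ T) (hL0 : ∀ x u, 0 ≤ L x u)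
    (hlsc : LowerSemicontinuous fun q : E × E => L q.1 q.2)
    (hconv : ∀ x, ConvexOn ℝ univ (L x)) (hcoer : UniformlyCoercive L) {s : ℝ}
    (hs : s ∈ Icc 0 T) : x₀ + ∫ τ in (0 : ℝ)..s, deriv y τ = y s := by
  have := FiniteDimensional.complete ℝ E
  have hac : AbsolutelyContinuousOnInterval y 0 s :=
    (h.absolutelyContinuousOnInterval hT hL0 hcoer).mono (by
      rw [uIcc_of_le hs.1, uIcc_of_le hT]
      exact Icc_subset_Icc_right hs.2)
  have hint : IntervalIntegrable (deriv y) MeasureTheory.volume 0 s :=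
    (h.intervalIntegrable_deriv hT hL0 hlsc hconv hcoer).mono_set (by
      rw [uIcc_of_le hs.1, uIcc_of_le hT]
      exact Icc_subset_Icc_right hs.2)
  rw [← h.start_eq, ← eq_sub_iff_add_eq']
  refine (SeparatingDual.eq_iff_forall_dual_eq (R := ℝ)).2 fun p => ?_
  rw [← p.intervalIntegral_comp_comm hint, map_sub, ← (hac.clm_comp p).integral_deriv_eq_sub]
  refine intervalIntegral.integral_congr_ae ?_
  filter_upwards [hac.boundedVariationOn.ae_differentiableAt_of_mem_uIcc] with τ hτ hτs
  exact (p.hasFDerivAt.comp_hasDerivAt τ (hτ (uIoc_subset_uIcc hτs)).hasDerivAt).deriv.symm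

end IsDescentPath

end Descent

lemma IsDescentPath.bolzaValue_le {n : ℕ} {L : Euc n → Euc n → ℝ} {W : ℝ × Euc n → EReal}
    {φ : Euc n → EReal} {T : ℝ} {x₀ : Euc n} {w₀ : ℝ} {y : ℝ → Euc n} {w : ℝ → ℝ}
    (h : IsDescentPath L W T x₀ w₀ y w) (hT : 0 ≤ T) (hL0 : ∀ x u, 0 ≤ L x u)
    (hlsc : LowerSemicontinuous fun q : Euc n × Euc n => L q.1 q.2)
    (hconv : ∀ x, ConvexOn ℝ univ (L x)) (hcoer : UniformlyCoercive L)
    (hinit : ∀ x, W (0, x) = φ x) : bolzaValue L φ T x₀ ≤ (w₀ : EReal) := by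
  have hpath : ∀ s ∈ Icc 0 T, x₀ + ∫ τ in (0 : ℝ)..s, deriv y τ = y s := fun s hs =>
    h.add_integral_deriv_eq hT hL0 hlsc hconv hcoer hs
  have hmono := h.monotoneOn_neg hL0
  rw [← uIcc_of_le hT] at hmono
  have hL : ∀ᵐ s, s ∈ Ioc 0 T →
      L (x₀ + ∫ τ in (0 : ℝ)..s, deriv y τ) (deriv y s) ≤ deriv (fun s => -w s) s := by
    filter_upwards [h.ae_lagrangian_le hT hL0 hlsc hconv hcoer] with s hs hsT
    rw [hpath s ⟨hsT.1.le, hsT.2⟩]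
    exact hs hsT
  have hint : IntervalIntegrable
      (fun s => L (x₀ + ∫ τ in (0 : ℝ)..s, deriv y τ) (deriv y s)) MeasureTheory.volume 0 T := by
    refine hmono.intervalIntegrable_deriv.mono_fun' ?_ ?_
    · rw [uIoc_of_le hT]
      have hcont : ContinuousOn y (Ioc 0 T) := by
        refine (h.absolutelyContinuousOnInterval hT hL0 hcoer).continuousOn.mono ?_
        rw [uIcc_of_le hT]
        exact Ioc_subset_Icc_self
      have hm : AEMeasurable (fun s => L (y s) (deriv y s))
          (MeasureTheory.volume.restrict (Ioc 0 T)) :=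
        hlsc.measurable.comp_aemeasurable
          ((hcont.aemeasurable measurableSet_Ioc).prodMk (measurable_deriv y).aemeasurable)
      refine hm.aestronglyMeasurable.congr ?_
      filter_upwards [MeasureTheory.ae_restrict_mem measurableSet_Ioc] with s hs
      rw [hpath s ⟨hs.1.le, hs.2⟩]
    · rw [uIoc_of_le hT, Filter.EventuallyLE, MeasureTheory.ae_restrict_iff' measurableSet_Ioc]
      filter_upwards [hL] with s hs hsT
      rw [Real.norm_of_nonneg (hL0 _ _)]
      exact hs hsT
  have hle : bolzaValue L φ T x₀ ≤
      ((∫ s in (0 : ℝ)..T, L (x₀ + ∫ τ in (0 : ℝ)..s, deriv y τ) (deriv y s) : ℝ) : EReal) +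
        φ (x₀ + ∫ τ in (0 : ℝ)..T, deriv y τ) :=
    sInf_le ⟨deriv y, h.intervalIntegrable_deriv hT hL0 hlsc hconv hcoer, hint, rfl⟩
  refine hle.trans ?_
  rw [hpath T ⟨hT, le_rfl⟩, ← hinit]
  have h1 : ∫ s in (0 : ℝ)..T, L (x₀ + ∫ τ in (0 : ℝ)..s, deriv y τ) (deriv y s) ≤
      ∫ s in (0 : ℝ)..T, deriv (fun s => -w s) s := by
    rw [intervalIntegral.integral_of_le hT, intervalIntegral.integral_of_le hT]
    refine MeasureTheory.setIntegral_mono_on_ae hint.1 hmono.intervalIntegrable_deriv.1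
      measurableSet_Ioc hL
  have h2 := hmono.intervalIntegral_deriv_mem_uIcc
  have h3 : -w 0 ≤ -w T := hmono (by simp) (by simp) hT
  rw [uIcc_of_le (by linarith)] at h2
  calc _ ≤ ((w₀ - w T : ℝ) : EReal) + (w T : EReal) := by
        refine add_le_add (EReal.coe_le_coe_iff.2 ?_) h.end_value
        have := h2.2
        rw [← h.start_value]
        linarith
    _ = (w₀ : EReal) := by
        rw [← EReal.coe_add, sub_add_cancel]

theorem stmt15 {n : ℕ} (L : Euc n → Euc n → ℝ) (Θ : Euc n → ℝ) (φ : Euc n → EReal)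
    (W : ℝ × Euc n → EReal)
    (hL0 : ∀ x u, 0 ≤ L x u)
    (hLlsc : LowerSemicontinuous (fun q : Euc n × Euc n => L q.1 q.2))
    (hLloc : ∀ q : Euc n × Euc n, ∃ U ∈ 𝓝 q, ∃ C : ℝ, ∀ r ∈ U, L r.1 r.2 ≤ C)
    (hconv : ∀ x, ConvexOn ℝ Set.univ (L x))
    (hΘ0 : ∀ u, 0 ≤ Θ u) (hΘsl : Superlinear Θ) (hcoer : ∀ x u, Θ u ≤ L x u)
    (hφ0 : ∀ x, 0 ≤ φ x) (hφlsc : LowerSemicontinuous φ)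
    (hW0 : ∀ q, 0 ≤ W q)
    (hWlsc : LowerSemicontinuousOn W {q : ℝ × Euc n | 0 ≤ q.1})
    (hinit : ∀ x, W (0, x) = φ x)
    (hcontsuper : ∀ t : ℝ, ∀ x : Euc n, 0 < t → W (t, x) ≠ ⊤ →
      ∃ u : Euc n, Dup W (t, x) ((-1:ℝ), u) ≤ ((-(L x u) : ℝ) : EReal)) :
    ∀ t : ℝ, ∀ x : Euc n, 0 ≤ t → bolzaValue L φ t x ≤ W (t, x) := by
  intro t x ht
  have hcoercive : UniformlyCoercive L := fun M => by
    obtain ⟨C, hC, hCΘ⟩ := hΘsl.exists_le hΘ0 M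
    exact ⟨C, hC, fun x u => (hCΘ u).trans (hcoer x u)⟩
  induction hw : W (t, x) with
  | top => exact le_top
  | bot => exact absurd (hW0 (t, x)) (by simp [hw])
  | coe w₀ =>
    obtain ⟨y, w, hyw⟩ := exists_isDescentPath ht hL0 hcoercive hW0 hWlsc hcontsuper hw.le
    exact hyw.bolzaValue_le ht hL0 hLlsc hconv hcoercive hinit
end
end
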